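/- arXiv:2405.11946 — 3 statements merged into one kernel-verified Lean document; each statement's English description precedes it below -/
import Mathlib

section
/- Let n ≥ 3 and k = 1. If n is even, then neither the sun graph S(n; 1) nor the complete sun graph S̄(n; 1) (each having 2n vertices) admits a connected partition of type (n+1, n−1); if n is odd, neither admits a connected partition of type (n, n). Consequently S(n; 1) and S̄(n; 1) are not e-positive. -/
noncomputable section

open SimpleGraph

/-- The chromatic symmetric function of a finite simple graph, as a formal power
series in countably many commuting variables `x_0, x_1, x_2, …`: the coefficient of the
monomial `∏ i, x_i ^ d i` is the number of proper colourings `κ : V → ℕ` in which colour `i`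
is used exactly `d i` times. -/
def csf {V : Type} [Fintype V] (G : SimpleGraph V) : MvPowerSeries ℕ ℚ :=
  fun d => (Nat.card {κ : V → ℕ //
      (∀ u v : V, G.Adj u v → κ u ≠ κ v) ∧
      ∀ i : ℕ, Nat.card {v : V // κ v = i} = d i} : ℚ)

/-- The elementary symmetric function `e_k` as a formal power series. -/
def esym (k : ℕ) : MvPowerSeries ℕ ℚ :=
  fun d => if (∀ i ∈ d.support, d i = 1) ∧ (d.sum fun _ v => v) = k then 1 else 0

/-- `e_λ` for a partition `λ` given as a multiset of parts. -/
def esymM (μ : Multiset ℕ) : MvPowerSeries ℕ ℚ :=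
  (μ.map esym).prod

/-- A symmetric function is `e`-positive if it is a finite nonnegative linear combination
of the elementary symmetric functions `e_λ`, `λ` a partition (all parts positive). -/
def EPositive (f : MvPowerSeries ℕ ℚ) : Prop :=
  ∃ c : Multiset ℕ →₀ ℚ, (∀ μ, 0 ≤ c μ) ∧ (∀ μ ∈ c.support, 0 ∉ μ) ∧
    f = c.sum fun μ a => a • esymM μ

/-- The path `P_k` on `k` vertices. -/
def pathG (k : ℕ) : SimpleGraph (Fin k) :=
  SimpleGraph.fromRel (fun i j => (j : ℕ) = (i : ℕ) + 1)

/-- The cycle `C_m` on `m` vertices (for `m = 2` this is a single edge, i.e. `P_2`). -/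
def cycleG (m : ℕ) : SimpleGraph (Fin m) :=
  SimpleGraph.fromRel (fun i j => (j : ℕ) = ((i : ℕ) + 1) % m)

/-- Auxiliary relation for sun graphs: body relation on `Fin n`, plus rays
`P_{lam i}` attached at vertex `i`, the leaf `⟨i,0⟩` of ray `i` being joined to `i`. -/
def sunRel (n : ℕ) (lam : Fin n → ℕ) (body : Fin n → Fin n → Prop) :
    (Fin n ⊕ ((i : Fin n) × Fin (lam i))) → (Fin n ⊕ ((i : Fin n) × Fin (lam i))) → Prop
  | Sum.inl i, Sum.inl i' => body i i'
  | Sum.inl i, Sum.inr p => p.1 = i ∧ (p.2 : ℕ) = 0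
  | Sum.inr p, Sum.inr q => p.1 = q.1 ∧ (q.2 : ℕ) = (p.2 : ℕ) + 1
  | _, _ => False

/-- The sun graph `S(n; λ_1, …, λ_n)`: a cycle `C_n` with a path `P_{λ_i}` (a *ray*)
joined by an edge to the `i`-th cycle vertex, for each `i`. -/
def sunGraph (n : ℕ) (lam : Fin n → ℕ) :
    SimpleGraph (Fin n ⊕ ((i : Fin n) × Fin (lam i))) :=
  SimpleGraph.fromRel (sunRel n lam (fun i i' => (i' : ℕ) = ((i : ℕ) + 1) % n))

/-- The complete sun graph `S̄(n; λ_1, …, λ_n)`: as `sunGraph`, but with complete body `K_n`. -/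
def completeSunGraph (n : ℕ) (lam : Fin n → ℕ) :
    SimpleGraph (Fin n ⊕ ((i : Fin n) × Fin (lam i))) :=
  SimpleGraph.fromRel (sunRel n lam (fun i i' => i ≠ i'))

/-- The spider `S(μ_1, …, μ_d)`: `d` paths (legs) `P_{μ_i}`, each joined at a leaf to a
common centre vertex. -/
def spiderGraph (d : ℕ) (mu : Fin d → ℕ) :
    SimpleGraph (Unit ⊕ ((i : Fin d) × Fin (mu i))) :=
  SimpleGraph.fromRel (fun a b => match a, b with
    | Sum.inl _, Sum.inr p => (p.2 : ℕ) = 0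
    | Sum.inr p, Sum.inr q => p.1 = q.1 ∧ (q.2 : ℕ) = (p.2 : ℕ) + 1
    | _, _ => False)

/-- The graph obtained from a body graph `H` on `Fin n` by joining each body vertex `i`
by an edge to a chosen vertex `u i` of a graph `Gs i`. -/
def attachGraph {n : ℕ} {Vs : Fin n → Type} (H : SimpleGraph (Fin n))
    (Gs : ∀ i, SimpleGraph (Vs i)) (u : ∀ i, Vs i) :
    SimpleGraph (Fin n ⊕ ((i : Fin n) × Vs i)) :=
  SimpleGraph.fromRel (fun a b => match a, b with
    | Sum.inl i, Sum.inl i' => H.Adj i i'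
    | Sum.inl i, Sum.inr p => p.1 = i ∧ p.2 = u p.1
    | Sum.inr p, Sum.inr q => ∃ h : p.1 = q.1, (Gs q.1).Adj (h ▸ p.2) q.2
    | _, _ => False)

/-- `G` has a connected partition of type `μ`: a partition of the vertex set all of whose
blocks induce connected subgraphs, the multiset of block sizes being `μ`. -/
def HasConnectedPartition {V : Type} [Fintype V] [DecidableEq V]
    (G : SimpleGraph V) (μ : Multiset ℕ) : Prop :=
  ∃ P : Finpartition (Finset.univ : Finset V),
    (∀ p ∈ P.parts, (G.induce (↑p : Set V)).Connected) ∧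
      P.parts.val.map Finset.card = μ

/-- `G` has a perfect matching: a partition of `V(G)` into pairs of adjacent vertices. -/
def HasPerfectMatching {V : Type} (G : SimpleGraph V) : Prop :=
  ∃ M : G.Subgraph, M.IsPerfectMatching

/-- `G` has an almost perfect matching: a partition of `V(G)` into pairs of adjacent
vertices together with one singleton. -/
def HasAlmostPerfectMatching {V : Type} (G : SimpleGraph V) : Prop :=
  ∃ M : G.Subgraph, M.IsMatching ∧ ∃ v : V, M.verts = {v}ᶜ

/-- The tadpole graph `T_{m,l}`: the cycle `C_m` (vertices `0, …, m-1`, consecutive edges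
plus the chord `{0, m-1}`) with a path on `l` further vertices attached by an edge at
vertex `m-1`.  For `l = 0` this is just `C_m`. -/
def tadpole (m l : ℕ) : SimpleGraph (Fin (m + l)) :=
  SimpleGraph.fromRel (fun i j =>
    (j : ℕ) = (i : ℕ) + 1 ∨ ((i : ℕ) = 0 ∧ (j : ℕ) = m - 1))

/-- Dumbbell with path-parameter `t = l + 1 ≥ 0`: vertices `0, …, m-1` form the cycle `C_m`
(consecutive edges plus chord `{0, m-1}`), vertices `m+t-1, …, m+n+t-2` form the cycle `C_n`
(consecutive edges plus chord `{m+t-1, m+n+t-2}`), and the vertices in between form the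
connecting path; for `t = 0` (i.e. `l = -1`) the two cycles share the vertex `m-1`. -/
def dumbbellAux (m n t : ℕ) : SimpleGraph (Fin (m + n + t - 1)) :=
  SimpleGraph.fromRel (fun i j =>
    (j : ℕ) = (i : ℕ) + 1
      ∨ ((i : ℕ) = 0 ∧ (j : ℕ) = m - 1)
      ∨ ((i : ℕ) = m + t - 1 ∧ (j : ℕ) = m + n + t - 2))

/-- The dumbbell graph `D(m, l, n)` for `l ≥ -1`: cycles `C_m` and `C_n` joined by a path
on `l` vertices (for `l = 1` a single joining vertex, for `l = 0` a joining edge, and for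
`l = -1` the two cycles share a vertex). -/
def dumbbell (m n : ℕ) (l : ℤ) : SimpleGraph (Fin (m + n + (l + 1).toNat - 1)) :=
  dumbbellAux m n (l + 1).toNat

end

/-- The sum over proper colourings of `G` with palette `ι` of the product of the weights of the
colours. -/
noncomputable def colouringSum {V ι : Type*} [Fintype V] [DecidableEq V] [Fintype ι]
    (G : SimpleGraph V) (y : ι → ℂ) : ℂ :=
  ∑ κ : V → ι, open Classical in if ∀ u v, G.Adj u v → κ u ≠ κ v then ∏ v, y (κ v) else 0

section Specialization

variable {x : ℕ → ℂ} {m : ℕ}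

lemma hasSubst_C_mul_X (hx : ∀ i, m ≤ i → x i = 0) :
    MvPowerSeries.HasSubst (fun s => (PowerSeries.C (x s) * PowerSeries.X : PowerSeries ℂ)) where
  const_coeff s := by
    have :
        MvPowerSeries.constantCoeff (PowerSeries.C (x s) * PowerSeries.X : PowerSeries ℂ) = 0 := by
      change PowerSeries.constantCoeff (PowerSeries.C (x s) * PowerSeries.X : PowerSeries ℂ) = 0
      simp
    rw [this]
    exact IsNilpotent.zero
  coeff_zero d := by
    refine (Finset.range m).finite_toSet.subset fun s hs => ?_
    by_contra h
    have h' : m ≤ s := by simpa using h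
    simp [hx s h'] at hs

/-- The specialization `x_i ↦ x i * t` of power series in countably many variables, for a
sequence `x` that vanishes from `m` on. -/
noncomputable def specialize (hx : ∀ i, m ≤ i → x i = 0) :
    MvPowerSeries ℕ ℚ →ₐ[ℚ] PowerSeries ℂ :=
  MvPowerSeries.substAlgHom (hasSubst_C_mul_X hx)

lemma coeff_specialize (hx : ∀ i, m ≤ i → x i = 0) (f : MvPowerSeries ℕ ℚ) (N : ℕ) :
    PowerSeries.coeff N (specialize hx f) =
      ∑ d ∈ (Finset.range m).finsuppAntidiag N,
        MvPowerSeries.coeff d f • d.prod fun s e => x s ^ e := by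
  have key (d : ℕ →₀ ℕ) : MvPowerSeries.coeff (Finsupp.single () N)
      (d.prod fun s e => (PowerSeries.C (x s) * PowerSeries.X : PowerSeries ℂ) ^ e) =
      if d.sum (fun _ e => e) = N then d.prod fun s e => x s ^ e else 0 := by
    have : (d.prod fun s e => (PowerSeries.C (x s) * PowerSeries.X : PowerSeries ℂ) ^ e) =
        PowerSeries.C (d.prod fun s e => x s ^ e) * PowerSeries.X ^ (d.sum fun _ e => e) := by
      simp only [Finsupp.prod, Finsupp.sum, mul_pow, Finset.prod_mul_distrib, map_prod, map_pow,
        Finset.prod_pow_eq_pow_sum]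
    rw [this]
    change PowerSeries.coeff N _ = _
    rw [PowerSeries.coeff_C_mul_X_pow]
    simp only [eq_comm]
  change MvPowerSeries.coeff (Finsupp.single () N) (specialize hx f) = _
  rw [specialize, MvPowerSeries.substAlgHom_apply, MvPowerSeries.coeff_subst (hasSubst_C_mul_X hx)]
  simp only [key]
  rw [finsum_eq_sum_of_support_subset (s := (Finset.range m).finsuppAntidiag N)]
  · refine Finset.sum_congr rfl fun d hd => ?_
    rw [if_pos (Finset.mem_finsuppAntidiag'.1 hd).1]
  · intro d hd
    simp only [Function.mem_support, ne_eq, smul_eq_zero, not_or, ite_eq_right_iff,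
      Classical.not_imp] at hd
    refine Finset.mem_coe.2 (Finset.mem_finsuppAntidiag'.2 ⟨hd.2.1, fun i hi => ?_⟩)
    by_contra h
    refine hd.2.2 (Finset.prod_eq_zero hi ?_)
    change x i ^ d i = 0
    rw [hx i (by simpa using h), zero_pow (by simpa using hi)]

lemma specialize_esym (hx : ∀ i, m ≤ i → x i = 0) (k : ℕ) :
    specialize hx (esym k) = PowerSeries.C (∑ t ∈ (Finset.range m).powersetCard k, ∏ i ∈ t, x i) *
      PowerSeries.X ^ k := by
  ext N
  rw [coeff_specialize, PowerSeries.coeff_C_mul_X_pow]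
  have hcoeff (d : ℕ →₀ ℕ) : MvPowerSeries.coeff d (esym k) =
      if (∀ i ∈ d.support, d i = 1) ∧ (d.sum fun _ v => v) = k then 1 else 0 := rfl
  split_ifs with hN
  · subst hN
    simp only [hcoeff, ite_smul, one_smul, zero_smul, ← Finset.sum_filter]
    refine Finset.sum_nbij' (fun d => d.support) (fun t => ∑ i ∈ t, Finsupp.single i 1)
      ?_ ?_ ?_ ?_ ?_
    · intro d hd
      simp only [Finset.mem_filter, Finset.mem_finsuppAntidiag', Finset.mem_powersetCard] at hd ⊢
      refine ⟨hd.1.2, ?_⟩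
      rw [← hd.1.1, Finsupp.sum, Finset.sum_congr rfl hd.2.1]
      simp
    · intro t ht
      simp only [Finset.mem_filter, Finset.mem_finsuppAntidiag', Finset.mem_powersetCard] at ht ⊢
      have happ (j : ℕ) : (∑ i ∈ t, Finsupp.single i 1 : ℕ →₀ ℕ) j = if j ∈ t then 1 else 0 := by
        simp [Finsupp.finsetSum_apply, Finsupp.single_apply]
      have hsupp : (∑ i ∈ t, Finsupp.single i 1 : ℕ →₀ ℕ).support = t := by
        ext j
        simp [happ]
      have hsum : ((∑ i ∈ t, Finsupp.single i 1 : ℕ →₀ ℕ).sum fun _ v => v) = N := by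
        rw [Finsupp.sum, hsupp, ← ht.2, Finset.card_eq_sum_ones]
        exact Finset.sum_congr rfl fun j hj => by rw [happ, if_pos hj]
      refine ⟨⟨hsum, hsupp.le.trans ht.1⟩, fun i hi => ?_, hsum⟩
      rw [hsupp] at hi
      rw [happ, if_pos hi]
    · intro d hd
      simp only [Finset.mem_filter] at hd
      ext j
      simp only [Finsupp.finsetSum_apply, Finsupp.single_apply, Finset.sum_ite_eq']
      split_ifs with hj
      · exact (hd.2.1 j hj).symm
      · simpa [eq_comm] using hj
    · intro t _
      ext j
      simp [Finsupp.finsetSum_apply, Finsupp.single_apply]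
    · intro d hd
      simp only [Finset.mem_filter] at hd
      refine Finset.prod_congr rfl fun i hi => ?_
      simp [hd.2.1 i hi]
  · refine Finset.sum_eq_zero fun d hd => ?_
    rw [hcoeff, if_neg, zero_smul]
    rintro ⟨-, h⟩
    exact hN ((Finset.mem_finsuppAntidiag'.1 hd).1.symm.trans h)

lemma coeff_specialize_csf {V : Type} [Fintype V] [DecidableEq V] (hx : ∀ i, m ≤ i → x i = 0)
    (G : SimpleGraph V) :
    PowerSeries.coeff (Fintype.card V) (specialize hx (csf G)) =
      colouringSum G (fun i : Fin m => x i) := by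
  classical
  have hsum : colouringSum G (fun i : Fin m => x i) =
      ∑ κ : V → Fin m with ∀ u v, G.Adj u v → κ u ≠ κ v, ∏ v, x (κ v) := by
    rw [colouringSum, Finset.sum_filter]
    congr!
  set content : (V → Fin m) → ℕ →₀ ℕ := fun κ => ∑ v, Finsupp.single (κ v : ℕ) 1 with hcontent
  have happ (κ : V → Fin m) (i : ℕ) :
      content κ i = (Finset.univ.filter fun v => (κ v : ℕ) = i).card := by
    simp [hcontent, Finsupp.finsetSum_apply, Finsupp.single_apply]
  have hprod (κ : V → Fin m) : (content κ).prod (fun s e => x s ^ e) = ∏ v, x (κ v) := by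
    rw [hcontent, ← Finsupp.prod_finsetSum_index (by simp) (by simp [pow_add])]
    simp
  have hmem (κ : V → Fin m) : content κ ∈ (Finset.range m).finsuppAntidiag (Fintype.card V) := by
    rw [Finset.mem_finsuppAntidiag']
    constructor
    · rw [hcontent, ← Finsupp.sum_finsetSum_index (by simp) (by simp)]
      simp
    · intro i hi
      rw [Finsupp.mem_support_iff, happ, Finset.card_ne_zero] at hi
      obtain ⟨v, hv⟩ := hi
      simp only [Finset.mem_filter, Finset.mem_univ, true_and] at hv
      simp [← hv]
  have hcsf (d : ℕ →₀ ℕ) (hd : d ∈ (Finset.range m).finsuppAntidiag (Fintype.card V)) :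
      MvPowerSeries.coeff d (csf G) =
        ((Finset.univ.filter fun κ : V → Fin m =>
          (∀ u v, G.Adj u v → κ u ≠ κ v) ∧ content κ = d).card : ℚ) := by
    change ((Nat.card _ : ℕ) : ℚ) = _
    rw [← Fintype.card_subtype, ← Nat.card_eq_fintype_card]
    congr 1
    let F (κ : {κ : V → Fin m // (∀ u v, G.Adj u v → κ u ≠ κ v) ∧ content κ = d}) :
        {κ : V → ℕ // (∀ u v, G.Adj u v → κ u ≠ κ v) ∧ ∀ i, Nat.card {v // κ v = i} = d i} :=
      ⟨fun v => κ.1 v, fun u v huv h => κ.2.1 u v huv (Fin.ext h), fun i => by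
        rw [Nat.card_eq_fintype_card, Fintype.card_subtype, ← happ κ.1 i, κ.2.2]⟩
    refine (Nat.card_congr (Equiv.ofBijective F ⟨?_, ?_⟩)).symm
    · intro κ κ' h
      exact Subtype.ext (funext fun v => Fin.ext (congrFun (congrArg Subtype.val h) v))
    · rintro ⟨κ, hκ, hcard⟩
      have hlt (v : V) : κ v < m := by
        have h0 : d (κ v) ≠ 0 := by
          have : Nonempty {w // κ w = κ v} := ⟨⟨v, rfl⟩⟩
          rw [← hcard]
          exact Nat.card_pos.ne'
        simpa using (Finset.mem_finsuppAntidiag'.1 hd).2 (Finsupp.mem_support_iff.2 h0)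
      refine ⟨⟨fun v => ⟨κ v, hlt v⟩, fun u v huv h => hκ u v huv (by simpa using h), ?_⟩, rfl⟩
      ext i
      rw [happ, ← hcard, Nat.card_eq_fintype_card, Fintype.card_subtype]
  rw [coeff_specialize, Finset.sum_congr rfl fun d hd => by rw [hcsf d hd], hsum,
    ← Finset.sum_fiberwise_of_maps_to (g := content) (fun κ _ => hmem κ)]
  refine Finset.sum_congr rfl fun d _ => ?_
  rw [Finset.filter_filter, Finset.sum_congr rfl (g := fun _ => d.prod fun s e => x s ^ e)]
  · simp [Finset.sum_const, Algebra.smul_def]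
  · intro κ hκ
    simp only [Finset.mem_filter] at hκ
    rw [← hκ.2.2, hprod]

end Specialization

lemma EPositive.coeff_specialize_re_nonneg {x : ℕ → ℂ} {m : ℕ} (hx : ∀ i, m ≤ i → x i = 0)
    (hE : ∀ k, ∃ r : ℕ, ∑ t ∈ (Finset.range m).powersetCard k, ∏ i ∈ t, x i = r)
    {f : MvPowerSeries ℕ ℚ} (hf : EPositive f) (N : ℕ) :
    0 ≤ (PowerSeries.coeff N (specialize hx f)).re := by
  obtain ⟨c, hc, -, rfl⟩ := hf
  have key (μ : Multiset ℕ) :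
      ∃ r s : ℕ, specialize hx (esymM μ) = PowerSeries.C (r : ℂ) * PowerSeries.X ^ s := by
    induction μ using Multiset.induction_on with
    | empty => exact ⟨1, 0, by simp [esymM]⟩
    | cons k μ ih =>
      obtain ⟨r, s, hrs⟩ := ih
      obtain ⟨q, hq⟩ := hE k
      refine ⟨q * r, k + s, ?_⟩
      have : esymM (k ::ₘ μ) = esym k * esymM μ := by simp [esymM]
      rw [this, map_mul, hrs, specialize_esym, hq]
      push_cast
      rw [map_mul]
      ring
  rw [Finsupp.sum, map_sum, map_sum, Complex.re_sum]
  refine Finset.sum_nonneg fun μ _ => ?_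
  obtain ⟨r, s, hrs⟩ := key μ
  rw [map_smul, hrs]
  have : PowerSeries.coeff N (c μ • (PowerSeries.C (r : ℂ) * PowerSeries.X ^ s)) =
      (c μ : ℂ) * if N = s then (r : ℂ) else 0 := by
    rw [map_rat_smul, PowerSeries.coeff_C_mul_X_pow, Rat.smul_def]
  rw [this]
  split_ifs
  · have := hc μ
    rw [← Complex.ofReal_ratCast, ← Complex.ofReal_natCast, ← Complex.ofReal_mul, Complex.ofReal_re]
    positivity
  · simp

section PowerSums

open Finset

lemma exists_alphabet {a b : ℕ} (ha : 0 < a) (hab : a ≤ b) :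
    ∃ x : ℕ → ℂ, (∀ i, b ≤ i → x i = 0) ∧ ∀ k, ∑ t ∈ (range b).powersetCard k, ∏ i ∈ t, x i =
      (if k = 0 then 1 else 0) + (if k = a then 1 else 0) + (if k = b then 1 else 0) := by
  open Polynomial in
  set Q : ℂ[X] := X ^ b + (X ^ (b - a) + C 1) with hQ
  have hdeg : (X ^ (b - a) + C 1 : ℂ[X]).degree < b := by
    refine (degree_add_le _ _).trans_lt (max_lt ?_ ?_)
    · rw [degree_X_pow]
      exact_mod_cast (by omega : b - a < b)
    · refine degree_C_le.trans_lt ?_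
      exact_mod_cast (by omega : 0 < b)
  have hmonic : Q.Monic := monic_X_pow_add hdeg
  have hnat : Q.natDegree = b := by
    rw [hQ, natDegree_add_eq_left_of_degree_lt, natDegree_X_pow]
    rwa [degree_X_pow]
  have hsplit : Q.Splits := IsAlgClosed.splits Q
  have hcard : Multiset.card Q.roots = b := by
    rw [← hnat]; exact hsplit.natDegree_eq_card_roots.symm
  set l := (Q.roots.map fun r => -r).toList with hl
  have hlen : l.length = b := by simp [hl, hcard]
  have hmap : (range b).val.map (fun i => l.getD i 0) = Q.roots.map fun r => -r := by
    rw [← Multiset.coe_toList (Q.roots.map fun r => -r), ← hl, range_val, Multiset.range,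
      Multiset.map_coe]
    congr 1
    refine List.ext_getElem (by simp [hlen]) fun i h₁ h₂ => ?_
    simp [h₂]
  have hprod : ((Q.roots.map fun r => -r).map fun r => X + C r).prod = Q := by
    rw [Multiset.map_map]
    conv_rhs => rw [hsplit.eq_prod_roots, hmonic.leadingCoeff]
    simp [sub_eq_add_neg]
  refine ⟨fun i => l.getD i 0, fun i hi => List.getD_eq_default _ _ (by omega), fun k => ?_⟩
  rw [← Finset.esymm_map_val, hmap]
  rcases le_or_gt k b with hk | hk
  · have := Multiset.prod_X_add_C_coeff (Q.roots.map fun r => -r) (k := b - k) (by simp [hcard])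
    rw [hprod, Multiset.card_map, hcard, Nat.sub_sub_self hk] at this
    rw [← this, hQ]
    simp only [coeff_add, coeff_X_pow, coeff_C]
    have h₁ : b - k = b ↔ k = 0 := by omega
    have h₂ : b - k = b - a ↔ k = a := by omega
    have h₃ : b - k = 0 ↔ k = b := by omega
    simp only [h₁, h₂, h₃, add_assoc]
  · rw [if_neg (by omega), if_neg (by omega), if_neg (by omega)]
    rw [Multiset.esymm, Multiset.powersetCard_eq_empty _ (by simpa [hcard] using hk)]
    simp

variable {ι : Type*} [Fintype ι] (y : ι → ℂ)

lemma powerSum_eq (k : ℕ) (hk : 0 < k) :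
    ∑ i, y i ^ k = (-1) ^ (k + 1) * k * ∑ t ∈ univ.powersetCard k, ∏ i ∈ t, y i -
      ∑ a ∈ antidiagonal k with a.1 ∈ Set.Ioo 0 k,
        (-1) ^ a.1 * (∑ t ∈ univ.powersetCard a.1, ∏ i ∈ t, y i) * ∑ i, y i ^ a.2 := by
  have := congrArg (MvPolynomial.aeval y) (MvPolynomial.psum_eq_mul_esymm_sub_sum ι ℂ k hk)
  simpa [MvPolynomial.psum, MvPolynomial.esymm, map_sum] using this

lemma mul_esymm_eq (k : ℕ) :
    k * ∑ t ∈ univ.powersetCard k, ∏ i ∈ t, y i = (-1) ^ (k + 1) *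
      ∑ a ∈ antidiagonal k with a.1 < k,
        (-1) ^ a.1 * (∑ t ∈ univ.powersetCard a.1, ∏ i ∈ t, y i) * ∑ i, y i ^ a.2 := by
  have := congrArg (MvPolynomial.aeval y) (MvPolynomial.mul_esymm_eq_sum ι ℂ k)
  simpa [MvPolynomial.psum, MvPolynomial.esymm, map_sum] using this

lemma mul_esymm_of_powerSum_eq_zero {n : ℕ} (hn : 3 ≤ n)
    (hp : ∀ k, 1 ≤ k → k ≤ n - 2 → ∑ i, y i ^ k = 0) :
    n * ∑ t ∈ univ.powersetCard n, ∏ i ∈ t, y i = (-1) ^ (n + 1) * ∑ i, y i ^ n := by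
  rw [mul_esymm_eq, Finset.sum_eq_single (0, n)]
  · simp
  · rintro ⟨i, j⟩ hij hne
    simp only [mem_filter, HasAntidiagonal.mem_antidiagonal] at hij
    have hi : i ≠ 0 := by
      rintro rfl
      exact hne (by simp; omega)
    by_cases h1 : i = 1
    · subst h1
      have := hp 1 le_rfl (by omega)
      simp [Finset.powersetCard_one, Finset.sum_map] at this ⊢
      simp [this]
    · rw [hp j (by omega) (by omega), mul_zero]
  · intro h
    simp at h
    omega

lemma powerSum_recursion {a b : ℕ} (ha : Odd a) (hb : Odd b)
    (he : ∀ k, ∑ t ∈ univ.powersetCard k, ∏ i ∈ t, y i =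
      (if k = 0 then 1 else 0) + (if k = a then 1 else 0) + (if k = b then 1 else 0))
    (k : ℕ) (hk : 0 < k) :
    ∑ i, y i ^ k = k * ((if k = a then 1 else 0) + (if k = b then 1 else 0)) +
      (if a < k then ∑ i, y i ^ (k - a) else 0) + (if b < k then ∑ i, y i ^ (k - b) else 0) := by
  have hsign (c : ℕ) (hc : Odd c) : ∑ p ∈ antidiagonal k with p.1 ∈ Set.Ioo 0 k,
      (if p.1 = c then ∑ i, y i ^ p.2 else 0) = if c < k then ∑ i, y i ^ (k - c) else 0 := by
    split_ifs with hck
    · rw [Finset.sum_eq_single (c, k - c)]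
      · simp
      · rintro ⟨i, j⟩ hij hne
        simp only [mem_filter, HasAntidiagonal.mem_antidiagonal] at hij
        refine if_neg fun h => hne ?_
        simp only at h
        exact Prod.ext h (by omega)
      · intro h
        have := hc.pos
        simp at h
        omega
    · refine Finset.sum_eq_zero fun p hp => if_neg ?_
      simp only [mem_filter, Set.mem_Ioo] at hp
      omega
  rw [powerSum_eq y k hk, ← hsign a ha, ← hsign b hb, sub_eq_add_neg, ← Finset.sum_neg_distrib,
    add_assoc, ← Finset.sum_add_distrib]
  congr 1
  · rw [he, if_neg hk.ne', zero_add]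
    rcases Nat.even_or_odd k with h | h
    · have h₁ : k ≠ a := by rintro rfl; exact Nat.not_even_iff_odd.2 ha h
      have h₂ : k ≠ b := by rintro rfl; exact Nat.not_even_iff_odd.2 hb h
      simp [h₁, h₂]
    · rw [(h.add_odd odd_one).neg_one_pow, one_mul]
  · refine Finset.sum_congr rfl fun p hp => ?_
    simp only [mem_filter, Set.mem_Ioo] at hp
    rw [he, if_neg hp.2.1.ne', zero_add]
    by_cases h₁ : p.1 = a
    · have : (-1 : ℂ) ^ p.1 = -1 := by rw [h₁, ha.neg_one_pow]
      rw [this]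
      split_ifs <;> ring
    · by_cases h₂ : p.1 = b
      · have : (-1 : ℂ) ^ p.1 = -1 := by rw [h₂, hb.neg_one_pow]
        rw [this]
        simp only [if_neg h₁, if_pos h₂]
        ring
      · simp [h₁, h₂]

lemma powerSums_of_esymm {a b n : ℕ} (ha : Odd a) (hb : Odd b) (hab : a ≤ b) (hn : a + b = 2 * n)
    (he : ∀ k, ∑ t ∈ univ.powersetCard k, ∏ i ∈ t, y i =
      (if k = 0 then 1 else 0) + (if k = a then 1 else 0) + (if k = b then 1 else 0)) :
    (∀ k, 0 < k → k < a → ∑ i, y i ^ k = 0) ∧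
    (∀ k, 0 < k → k < a → ∑ i, y i ^ (2 * k) = 0) ∧
    ∃ r : ℕ, 0 < r ∧ ∑ i, y i ^ (2 * n) = r := by
  have hrec := powerSum_recursion y ha hb he
  have ha0 := ha.pos
  have hsmall (k : ℕ) (hk : 0 < k) (hka : k < a) : ∑ i, y i ^ k = 0 := by
    rw [hrec k hk, if_neg (by omega), if_neg (by omega), if_neg (by omega), if_neg (by omega)]
    simp
  have hnat (k : ℕ) : 0 < k → ∃ r : ℕ, ∑ i, y i ^ k = r := by
    induction k using Nat.strong_induction_on with
    | _ k ih =>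
      intro hk
      have hstep (c : ℕ) (hc : 0 < c) :
          ∃ r : ℕ, (if c < k then ∑ i, y i ^ (k - c) else 0) = r := by
        split_ifs with h
        · exact ih (k - c) (by omega) (by omega)
        · exact ⟨0, by simp⟩
      obtain ⟨r, hr⟩ := hstep a ha0
      obtain ⟨s, hs⟩ := hstep b hb.pos
      refine ⟨k * ((if k = a then 1 else 0) + (if k = b then 1 else 0)) + r + s, ?_⟩
      rw [hrec k hk, hr, hs]
      push_cast
      rfl
  refine ⟨hsmall, fun k hk hka => ?_, ?_⟩
  · have hodd (c : ℕ) (hc : Odd c) : 2 * k ≠ c := by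
      rintro rfl
      exact Nat.not_even_iff_odd.2 hc (even_two_mul k)
    have hterm (c : ℕ) (hc : a ≤ c) :
        (if c < 2 * k then ∑ i, y i ^ (2 * k - c) else 0) = 0 := by
      split_ifs with h
      · exact hsmall _ (by omega) (by omega)
      · rfl
    rw [hrec _ (by omega), hterm a le_rfl, hterm b hab, if_neg (hodd a ha), if_neg (hodd b hb)]
    simp
  · obtain ⟨r, hr⟩ := hnat b hb.pos
    have hpa : ∑ i, y i ^ a = a * (1 + if a = b then 1 else 0) := by
      rw [hrec a ha0, if_pos rfl, if_neg (lt_irrefl a), if_neg (by omega : ¬ b < a)]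
      simp
    refine ⟨a * (1 + if a = b then 1 else 0) + r, by positivity, ?_⟩
    have hb0 := hb.pos
    rw [hrec _ (by omega), if_neg (by omega), if_neg (by omega), if_pos (by omega),
      if_pos (by omega), show 2 * n - a = b by omega, show 2 * n - b = a by omega, hr, hpa]
    push_cast
    ring

end PowerSums

section Colourings

open Finset

lemma colouringSum_pendant {n : ℕ} {ι : Type*} [Fintype ι] (y : ι → ℂ) (hy : ∑ i, y i = 0)
    {G : SimpleGraph (Fin n ⊕ ((_ : Fin n) × Fin 1))} {H : SimpleGraph (Fin n)}
    (hbody : ∀ i j, G.Adj (Sum.inl i) (Sum.inl j) ↔ H.Adj i j)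
    (hray : ∀ i p, G.Adj (Sum.inl i) (Sum.inr p) ↔ p.1 = i)
    (hleaf : ∀ p q, ¬ G.Adj (Sum.inr p) (Sum.inr q)) :
    colouringSum G y = (-1) ^ n * colouringSum H (fun i => y i ^ 2) := by
  classical
  let e : (Fin n ⊕ ((_ : Fin n) × Fin 1) → ι) ≃ (Fin n → ι) × (Fin n → ι) :=
    (Equiv.sumArrowEquivProdArrow _ _ _).trans
      ((Equiv.refl _).prodCongr ((Equiv.sigmaUnique (Fin n) fun _ => Fin 1).arrowCongr
        (Equiv.refl ι)))
  have he₁ (β l : Fin n → ι) (i) : e.symm (β, l) (Sum.inl i) = β i := rfl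
  have he₂ (β l : Fin n → ι) (p) : e.symm (β, l) (Sum.inr p) = l p.1 := rfl
  have hproper (β l : Fin n → ι) : (∀ u v, G.Adj u v → e.symm (β, l) u ≠ e.symm (β, l) v) ↔
      (∀ i j, H.Adj i j → β i ≠ β j) ∧ ∀ i, l i ≠ β i := by
    constructor
    · refine fun h => ⟨fun i j hij => ?_, fun i => ?_⟩
      · simpa only [he₁] using h _ _ ((hbody i j).2 hij)
      · simpa only [he₁, he₂] using (h _ _ ((hray i ⟨i, 0⟩).2 rfl)).symm
    · rintro ⟨h₁, h₂⟩ (i | p) (j | q) huv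
      · exact h₁ i j ((hbody i j).1 huv)
      · rw [he₁, he₂, (hray i q).1 huv]
        exact (h₂ i).symm
      · rw [he₁, he₂, (hray j p).1 huv.symm]
        exact h₂ j
      · exact absurd huv (hleaf p q)
  have hleaves (c : ι) : ∑ d, (if d ≠ c then y d else 0) = -y c := by
    rw [← sum_filter, eq_neg_iff_add_eq_zero, ← hy, ← Finset.sum_erase_add univ y (mem_univ c)]
    congr 2
    ext d
    simp
  unfold colouringSum
  rw [← e.symm.sum_comp, Fintype.sum_prod_type, mul_sum]
  refine sum_congr rfl fun β _ => ?_
  simp only [hproper, Fintype.prod_sum_type, he₁, he₂]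
  by_cases hβ : ∀ i j, H.Adj i j → β i ≠ β j
  · rw [if_pos hβ]
    have : ∏ i, (-y (β i)) = ∑ l : Fin n → ι, ∏ i, if l i ≠ β i then y (l i) else 0 := by
      simp only [← hleaves]
      rw [Finset.prod_univ_sum, Fintype.piFinset_univ]
    rw [Finset.prod_neg, card_univ, Fintype.card_fin] at this
    rw [prod_pow, sq, ← mul_assoc, this, sum_mul]
    refine sum_congr rfl fun l _ => ?_
    have hrays : ∏ p : (_ : Fin n) × Fin 1, y (l p.1) = ∏ i, y (l i) := by
      rw [Fintype.prod_sigma]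
      simp
    rw [hrays, Finset.prod_ite_zero]
    by_cases hl : ∀ i, l i ≠ β i
    · rw [if_pos ⟨hβ, hl⟩, if_pos fun i _ => hl i, mul_comm]
    · rw [if_neg fun h => hl h.2, if_neg fun h => hl fun i => h i (mem_univ i), zero_mul]
  · rw [if_neg hβ, mul_zero]
    exact sum_eq_zero fun l _ => if_neg fun h => hβ h.1

lemma colouringSum_top {n : ℕ} {ι : Type*} [Fintype ι] (z : ι → ℂ) :
    colouringSum (⊤ : SimpleGraph (Fin n)) z =
      n.factorial * ∑ t ∈ univ.powersetCard n, ∏ i ∈ t, z i := by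
  classical
  have hinj (β : Fin n → ι) :
      (∀ u v, (⊤ : SimpleGraph (Fin n)).Adj u v → β u ≠ β v) ↔ Function.Injective β := by
    simp only [SimpleGraph.top_adj, Function.Injective]
    exact forall₂_congr fun u v => not_imp_not
  unfold colouringSum
  simp only [hinj]
  rw [← sum_filter, ← sum_fiberwise_of_maps_to (g := fun β => univ.image β)
    (t := univ.powersetCard n), mul_sum]
  · refine sum_congr rfl fun t ht => ?_
    rw [mem_powersetCard] at ht
    rw [sum_congr rfl (g := fun _ => ∏ i ∈ t, z i), sum_const, nsmul_eq_mul]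
    · congr 2
      have hcard : Fintype.card (Fin n) = Fintype.card t := by simp [ht.2]
      have := Fintype.card_equiv (Fintype.equivOfCardEq hcard)
      rw [Fintype.card_fin] at this
      rw [← this, filter_filter, ← Fintype.card_subtype]
      let F (σ : Fin n ≃ t) : {β : Fin n → ι // Function.Injective β ∧ univ.image β = t} :=
        ⟨fun i => (σ i : ι), Subtype.val_injective.comp σ.injective, by
          ext c
          simp only [mem_image, mem_univ, true_and]
          exact ⟨fun ⟨i, hi⟩ => hi ▸ (σ i).2, fun hc => ⟨σ.symm ⟨c, hc⟩, by simp⟩⟩⟩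
      refine (Fintype.card_congr (Equiv.ofBijective F ⟨?_, ?_⟩)).symm
      · intro σ τ h
        exact Equiv.ext fun i => Subtype.ext (congrFun (congrArg Subtype.val h) i)
      · rintro ⟨β, hβ, him⟩
        have hmem (i : Fin n) : β i ∈ t := him ▸ mem_image_of_mem β (mem_univ i)
        refine ⟨Equiv.ofBijective (fun i => ⟨β i, hmem i⟩) ?_, rfl⟩
        rw [Fintype.bijective_iff_injective_and_card]
        exact ⟨fun i j h => hβ (congrArg Subtype.val h), hcard⟩
    · intro β hβ
      simp only [mem_filter] at hβ
      rw [← hβ.2, prod_image fun i _ j _ h => hβ.1.2 h]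
  · intro β hβ
    rw [mem_powersetCard]
    exact ⟨subset_univ _, by rw [card_image_of_injective _ (mem_filter.1 hβ).2, card_fin]⟩

lemma sum_prod_path_eq_matrix_pow {ι : Type*} [Fintype ι] [DecidableEq ι] (M : Matrix ι ι ℂ)
    (k : ℕ) (c : ι) (g : ι → ℂ) :
    ∑ β : Fin (k + 1) → ι,
      (if β 0 = c then (∏ i : Fin k, M (β i.castSucc) (β i.succ)) * g (β (Fin.last k)) else 0) =
      ∑ d, (M ^ k) c d * g d := by
  induction k generalizing g with
  | zero =>
    rw [← (Equiv.funUnique (Fin 1) ι).symm.sum_comp]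
    simp [Matrix.one_apply]
  | succ k ih =>
    have hsnoc : ∑ β : Fin (k + 2) → ι,
        (if β 0 = c then
          (∏ i : Fin (k + 1), M (β i.castSucc) (β i.succ)) * g (β (Fin.last (k + 1))) else 0) =
        ∑ β : Fin (k + 1) → ι, (if β 0 = c then (∏ i : Fin k, M (β i.castSucc) (β i.succ)) *
          ∑ d, M (β (Fin.last k)) d * g d else 0) := by
      rw [← (Fin.snocEquiv fun _ => ι).sum_comp, Fintype.sum_prod_type, sum_comm]
      refine sum_congr rfl fun β _ => ?_
      have h0 (d : ι) : (Fin.snoc β d : Fin (k + 2) → ι) 0 = β 0 :=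
        Fin.snoc_castSucc (α := fun _ => ι) d β 0
      have h1 (d : ι) (i : Fin k) :
          (Fin.snoc β d : Fin (k + 2) → ι) i.castSucc.succ = β i.succ :=
        Fin.snoc_castSucc (α := fun _ => ι) d β i.succ
      have h2 (d : ι) (i : Fin (k + 1)) :
          (Fin.snoc β d : Fin (k + 2) → ι) i.castSucc = β i :=
        Fin.snoc_castSucc (α := fun _ => ι) d β i
      have h3 (d : ι) : (Fin.snoc β d : Fin (k + 2) → ι) (Fin.last k).succ = d :=
        Fin.snoc_last (α := fun _ => ι) d β
      simp only [Fin.snocEquiv, Equiv.coe_fn_mk, Fin.snoc_last, h0, Fin.prod_univ_castSucc, h1, h2,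
        h3]
      split_ifs
      · rw [mul_sum]
        exact sum_congr rfl fun d _ => mul_assoc _ _ _
      · simp
    rw [hsnoc, ih fun d' => ∑ d, M d' d * g d, pow_succ]
    simp only [Matrix.mul_apply, mul_sum, sum_mul]
    rw [sum_comm]
    exact sum_congr rfl fun d _ => sum_congr rfl fun d' _ => by ring

lemma sum_prod_cycle_eq_trace_pow {ι : Type*} [Fintype ι] [DecidableEq ι] (M : Matrix ι ι ℂ)
    (k : ℕ) :
    ∑ β : Fin (k + 1) → ι, ∏ i, M (β i) (β (i + 1)) = (M ^ (k + 1)).trace := by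
  have (c : ι) := sum_prod_path_eq_matrix_pow M k c (fun d => M d c)
  simp only [pow_succ, Matrix.trace, Matrix.diag, Matrix.mul_apply, ← this]
  rw [sum_comm]
  refine sum_congr rfl fun β _ => ?_
  simp [Fin.prod_univ_castSucc]

lemma trace_pow_of_powerSum_eq_zero {ι : Type*} [Fintype ι] [DecidableEq ι] (z : ι → ℂ) {N : ℕ}
    (hN : 2 ≤ N) (hz : ∀ k, 1 ≤ k → k < N → ∑ i, z i ^ k = 0) :
    ((Matrix.of fun c d => if c ≠ d then z c else 0) ^ (N + 1)).trace =
      (-1) ^ N * (N * ∑ i, z i ^ (N + 1)) := by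
  set M : Matrix ι ι ℂ := Matrix.of fun c d => if c ≠ d then z c else 0 with hM
  have hmul (A : Matrix ι ι ℂ) (c d : ι) : (M * A) c d = z c * (∑ c', A c' d - A c d) := by
    rw [Matrix.mul_apply, ← Finset.sum_erase_add univ (fun c' => A c' d) (mem_univ c),
      add_sub_cancel_right, mul_sum, ← Finset.sum_erase_add univ _ (mem_univ c)]
    simp only [hM, Matrix.of_apply, ne_eq, not_true_eq_false, if_false, zero_mul, add_zero]
    refine sum_congr rfl fun c' hc' => ?_
    rw [if_pos (ne_of_mem_erase hc').symm]
  have hcol (k : ℕ) (d : ι) :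
      ∑ c, (-1) ^ k * ((if c = d then z c ^ k else 0) -
        ∑ i ∈ range k, z c ^ (i + 1) * z d ^ (k - 1 - i)) =
      (-1) ^ k * (z d ^ k - ∑ i ∈ range k, (∑ c, z c ^ (i + 1)) * z d ^ (k - 1 - i)) := by
    rw [← mul_sum, sum_sub_distrib, sum_comm]
    simp [sum_mul]
  have hpow (k : ℕ) (hk : k ≤ N) (c d : ι) : (M ^ k) c d = (-1) ^ k *
      ((if c = d then z c ^ k else 0) - ∑ i ∈ range k, z c ^ (i + 1) * z d ^ (k - 1 - i)) := by
    induction k generalizing c d with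
    | zero => simp [Matrix.one_apply]
    | succ k ih =>
      rw [pow_succ', hmul]
      simp only [ih (by omega)]
      rw [hcol, sum_eq_zero (s := range k) (f := fun i => (∑ c, z c ^ (i + 1)) * z d ^ (k - 1 - i))
        fun i hi => by rw [hz (i + 1) (by omega) (by rw [mem_range] at hi; omega), zero_mul],
        sum_range_succ', Nat.add_sub_cancel]
      have : ∑ i ∈ range k, z c ^ (i + 1 + 1) * z d ^ (k - (i + 1)) =
          z c * ∑ i ∈ range k, z c ^ (i + 1) * z d ^ (k - 1 - i) := by
        rw [mul_sum]
        refine sum_congr rfl fun i _ => ?_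
        rw [show k - (i + 1) = k - 1 - i by omega]
        ring
      rw [this]
      split_ifs <;> simp <;> ring
  obtain ⟨K, rfl⟩ : ∃ K, N = K + 1 := ⟨N - 1, by omega⟩
  have hp : ∑ i, z i = 0 := by simpa using hz 1 le_rfl (by omega)
  simp only [pow_succ' M (K + 1), Matrix.trace, Matrix.diag, hmul, hpow (K + 1) le_rfl, hcol]
  have hdiag (c : ι) : ∑ i ∈ range (K + 1), z c ^ (i + 1) * z c ^ (K + 1 - 1 - i) =
      (K + 1) * z c ^ (K + 1) := by
    rw [sum_congr rfl (g := fun _ => z c ^ (K + 1))]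
    · simp
    · intro i hi
      rw [mem_range] at hi
      rw [← pow_add]
      congr 1
      omega
  have hsum (c : ι) : ∑ i ∈ range (K + 1), (∑ c, z c ^ (i + 1)) * z c ^ (K + 1 - 1 - i) =
      ∑ c, z c ^ (K + 1) := by
    rw [sum_range_succ, sum_eq_zero]
    · simp
    · intro i hi
      rw [mem_range] at hi
      rw [hz (i + 1) (by omega) (by omega), zero_mul]
  simp only [hdiag, hsum, if_true]
  have hterm (c : ι) : z c * ((-1) ^ (K + 1) * (z c ^ (K + 1) - ∑ c, z c ^ (K + 1)) -
      (-1) ^ (K + 1) * (z c ^ (K + 1) - (K + 1) * z c ^ (K + 1))) =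
      (-1) ^ (K + 1) * ((K + 1) * z c ^ (K + 1 + 1)) -
        z c * ((-1) ^ (K + 1) * ∑ c, z c ^ (K + 1)) := by ring
  simp only [hterm]
  rw [sum_sub_distrib, ← sum_mul, hp, zero_mul, sub_zero, ← mul_sum, ← mul_sum]
  push_cast
  rfl

lemma colouringSum_cycleG {ι : Type*} [Fintype ι] (z : ι → ℂ) {N : ℕ} (hN : 1 ≤ N) :
    open Classical in colouringSum (cycleG (N + 1)) z =
      ((Matrix.of fun c d => if c ≠ d then z c else 0) ^ (N + 1)).trace := by
  classical
  have hproper (β : Fin (N + 1) → ι) :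
      (∀ u v, (cycleG (N + 1)).Adj u v → β u ≠ β v) ↔ ∀ i, β i ≠ β (i + 1) := by
    have hval (i : Fin (N + 1)) : ((i + 1 : Fin (N + 1)) : ℕ) = (i + 1) % (N + 1) := by
      simp [Fin.val_add]
    constructor
    · intro h i
      refine h i (i + 1) ((SimpleGraph.fromRel_adj _ _ _).2 ⟨?_, Or.inl (hval i)⟩)
      intro heq
      have : (1 : Fin (N + 1)) = 0 := by simpa using heq.symm
      have := congrArg Fin.val this
      rw [Fin.val_one', Fin.val_zero, Nat.mod_eq_of_lt (by omega)] at this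
      omega
    · intro h u v huv
      rcases ((SimpleGraph.fromRel_adj _ _ _).1 huv).2 with h' | h'
      · rw [Fin.ext (h'.trans (hval u).symm)]
        exact h u
      · rw [Fin.ext (h'.trans (hval v).symm)]
        exact (h v).symm
  rw [← sum_prod_cycle_eq_trace_pow]
  unfold colouringSum
  refine sum_congr rfl fun β _ => ?_
  simp only [hproper, Matrix.of_apply, prod_ite_zero, mem_univ, true_imp_iff]

end Colourings

section Partitions

variable {n : ℕ} {G : SimpleGraph (Fin n ⊕ ((_ : Fin n) × Fin 1))}

lemma even_card_of_connected_parts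
    (hray : ∀ i p, G.Adj (Sum.inl i) (Sum.inr p) ↔ p.1 = i)
    (hleaf : ∀ p q, ¬ G.Adj (Sum.inr p) (Sum.inr q))
    (P : Finpartition (Finset.univ : Finset (Fin n ⊕ ((_ : Fin n) × Fin 1))))
    (hconn : ∀ p ∈ P.parts, (G.induce (↑p : Set _)).Connected)
    (hcard : ∀ p ∈ P.parts, 2 ≤ p.card) {p : Finset _} (hp : p ∈ P.parts) : Even p.card := by
  have hdown (q) (hq : q ∈ P.parts) (i : Fin n) (hi : Sum.inr ⟨i, 0⟩ ∈ q) : Sum.inl i ∈ q := by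
    have : Nontrivial (↑q : Set (Fin n ⊕ ((_ : Fin n) × Fin 1))) :=
      Set.nontrivial_coe_sort.2 (Finset.one_lt_card_iff_nontrivial.1 (hcard q hq))
    obtain ⟨⟨w, hw⟩, hadj⟩ := (hconn q hq).preconnected.exists_adj_of_nontrivial ⟨_, hi⟩
    rw [SimpleGraph.comap_adj] at hadj
    rcases w with j | r
    · have := (hray j ⟨i, 0⟩).1 hadj.symm
      simp only at this
      exact this ▸ hw
    · exact absurd hadj (hleaf _ _)
  have hup (i : Fin n) (hi : Sum.inl i ∈ p) : Sum.inr ⟨i, 0⟩ ∈ p := by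
    obtain ⟨q, hq, hiq⟩ := P.exists_mem (Finset.mem_univ (Sum.inr ⟨i, 0⟩))
    rwa [P.eq_of_mem_parts hp hq hi (hdown q hq i hiq)]
  have hsum : p.toLeft.card = p.toRight.card := by
    refine Finset.card_nbij' (fun i => ⟨i, 0⟩) (fun r => r.1) ?_ ?_ ?_ ?_
    · intro i hi
      simpa using hup i (by simpa using hi)
    · rintro ⟨i, j⟩ hr
      obtain rfl := Subsingleton.elim j 0
      simpa using hdown p hp i (by simpa using hr)
    · intro i _
      rfl
    · rintro ⟨i, j⟩ _
      obtain rfl := Subsingleton.elim j 0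
      rfl
  rw [← Finset.card_toLeft_add_card_toRight, hsum]
  exact ⟨_, rfl⟩

lemma not_hasConnectedPartition_pair_of_odd
    (hray : ∀ i p, G.Adj (Sum.inl i) (Sum.inr p) ↔ p.1 = i)
    (hleaf : ∀ p q, ¬ G.Adj (Sum.inr p) (Sum.inr q)) {a b : ℕ} (ha : Odd a)
    (ha2 : 2 ≤ a) (hb2 : 2 ≤ b) : ¬ HasConnectedPartition G {a, b} := by
  rintro ⟨P, hconn, hP⟩
  have hcard (p) (hp : p ∈ P.parts) : 2 ≤ p.card := by
    have : p.card ∈ P.parts.val.map Finset.card := Multiset.mem_map_of_mem _ hp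
    rw [hP] at this
    simp only [Multiset.insert_eq_cons, Multiset.mem_cons, Multiset.mem_singleton] at this
    rcases this with h | h <;> omega
  have : a ∈ P.parts.val.map Finset.card := by simp [hP]
  obtain ⟨p, hp, rfl⟩ := Multiset.mem_map.1 this
  exact Nat.not_even_iff_odd.2 ha (even_card_of_connected_parts hray hleaf P hconn hcard hp)

end Partitions

lemma not_ePositive_of_pendant {n : ℕ} (hn : 3 ≤ n)
    {G : SimpleGraph (Fin n ⊕ ((_ : Fin n) × Fin 1))} {H : SimpleGraph (Fin n)}
    (hbody : ∀ i j, G.Adj (Sum.inl i) (Sum.inl j) ↔ H.Adj i j)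
    (hray : ∀ i p, G.Adj (Sum.inl i) (Sum.inr p) ↔ p.1 = i)
    (hleaf : ∀ p q, ¬ G.Adj (Sum.inr p) (Sum.inr q))
    {C : ℕ} (hC : 0 < C)
    (hH : ∀ m : ℕ, ∀ z : Fin m → ℂ, (∀ k, 1 ≤ k → k ≤ n - 2 → ∑ i, z i ^ k = 0) →
      colouringSum H z = (-1) ^ (n + 1) * (C * ∑ i, z i ^ n)) :
    ¬ EPositive (csf G) := by
  intro hG
  obtain ⟨a, b, ha, hb, hab, hsum, han, ha3⟩ : ∃ a b : ℕ, Odd a ∧ Odd b ∧ a ≤ b ∧ a + b = 2 * n ∧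
      n - 2 < a ∧ 3 ≤ a := by
    rcases Nat.even_or_odd n with h | h
    · obtain ⟨r, rfl⟩ := h
      exact ⟨r + r - 1, r + r + 1, ⟨r - 1, by omega⟩, ⟨r, by omega⟩, by omega, by omega, by omega,
        by omega⟩
    · exact ⟨n, n, h, h, le_rfl, by omega, by omega, hn⟩
  obtain ⟨x, hx, he⟩ := exists_alphabet ha.pos hab
  have he' (k : ℕ) : ∑ t ∈ (Finset.univ : Finset (Fin b)).powersetCard k, ∏ i ∈ t, x i =
      (if k = 0 then 1 else 0) + (if k = a then 1 else 0) + (if k = b then 1 else 0) := by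
    rw [← he k, ← Finset.esymm_map_val, ← Finset.esymm_map_val]
    congr 1
    have : Finset.range b = (Finset.univ : Finset (Fin b)).map Fin.valEmbedding := by
      ext i
      simp
    rw [this, Finset.map_val, Multiset.map_map]
    rfl
  obtain ⟨hp, hp2, r, hr, hpn⟩ := powerSums_of_esymm (fun i : Fin b => x i) ha hb hab hsum he'
  have hnonneg := hG.coeff_specialize_re_nonneg hx (fun k => ⟨(if k = 0 then 1 else 0) +
    (if k = a then 1 else 0) + (if k = b then 1 else 0), by rw [he k]; push_cast; rfl⟩) (2 * n)
  have hcard : Fintype.card (Fin n ⊕ ((_ : Fin n) × Fin 1)) = 2 * n := by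
    simp [two_mul]
  have hval : PowerSeries.coeff (2 * n) (specialize hx (csf G)) = -((C * r : ℕ) : ℂ) := by
    have hcsf := coeff_specialize_csf hx G
    rw [hcard] at hcsf
    rw [hcsf, colouringSum_pendant _ (by simpa using hp 1 one_pos (by omega)) hbody hray hleaf, hH]
    · simp only [← pow_mul, hpn]
      rw [← mul_assoc, ← pow_add, show n + (n + 1) = 2 * n + 1 by ring,
        (odd_two_mul_add_one n).neg_one_pow]
      push_cast
      ring
    · intro k hk hkn
      simpa only [← pow_mul] using hp2 k (by omega) (by omega)
  rw [hval, Complex.neg_re, Complex.natCast_re] at hnonneg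
  have : (0 : ℝ) < (C * r : ℕ) := by exact_mod_cast Nat.mul_pos hC hr
  linarith

lemma sunGraph_one_adj_inl (n : ℕ) (i j : Fin n) :
    (sunGraph n fun _ => 1).Adj (Sum.inl i) (Sum.inl j) ↔ (cycleG n).Adj i j := by
  simp [sunGraph, cycleG, sunRel]

lemma sunGraph_one_adj_inl_inr (n : ℕ) (i : Fin n) (p : (_ : Fin n) × Fin 1) :
    (sunGraph n fun _ => 1).Adj (Sum.inl i) (Sum.inr p) ↔ p.1 = i := by
  simp [sunGraph, sunRel]

lemma sunGraph_one_not_adj_inr (n : ℕ) (p q : (_ : Fin n) × Fin 1) :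
    ¬ (sunGraph n fun _ => 1).Adj (Sum.inr p) (Sum.inr q) := by
  simp [sunGraph, sunRel]

lemma completeSunGraph_one_adj_inl (n : ℕ) (i j : Fin n) :
    (completeSunGraph n fun _ => 1).Adj (Sum.inl i) (Sum.inl j) ↔
      (⊤ : SimpleGraph (Fin n)).Adj i j := by
  simp [completeSunGraph, sunRel]
  tauto

lemma completeSunGraph_one_adj_inl_inr (n : ℕ) (i : Fin n) (p : (_ : Fin n) × Fin 1) :
    (completeSunGraph n fun _ => 1).Adj (Sum.inl i) (Sum.inr p) ↔ p.1 = i := by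
  simp [completeSunGraph, sunRel]

lemma completeSunGraph_one_not_adj_inr (n : ℕ) (p q : (_ : Fin n) × Fin 1) :
    ¬ (completeSunGraph n fun _ => 1).Adj (Sum.inr p) (Sum.inr q) := by
  simp [completeSunGraph, sunRel]

/-- For `n ≥ 3`, if `n` is even then neither `S(n;1)` nor `S̄(n;1)` has a
connected partition of type `(n+1, n-1)`; if `n` is odd, neither has one of type `(n, n)`.
Consequently neither graph is `e`-positive. -/
theorem sun_all_rays_one_not_ePositive (n : ℕ) (hn : 3 ≤ n) :
    (Even n →
      ¬ HasConnectedPartition (sunGraph n fun _ => 1) {n + 1, n - 1} ∧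
      ¬ HasConnectedPartition (completeSunGraph n fun _ => 1) {n + 1, n - 1}) ∧
    (Odd n →
      ¬ HasConnectedPartition (sunGraph n fun _ => 1) {n, n} ∧
      ¬ HasConnectedPartition (completeSunGraph n fun _ => 1) {n, n}) ∧
    ¬ EPositive (csf (sunGraph n fun _ => 1)) ∧
    ¬ EPositive (csf (completeSunGraph n fun _ => 1)) := by
  have hsun {a b : ℕ} (ha : Odd a) (ha2 : 2 ≤ a) (hb2 : 2 ≤ b) :=
    not_hasConnectedPartition_pair_of_odd (sunGraph_one_adj_inl_inr n)
      (sunGraph_one_not_adj_inr n) ha ha2 hb2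
  have hcomplete {a b : ℕ} (ha : Odd a) (ha2 : 2 ≤ a) (hb2 : 2 ≤ b) :=
    not_hasConnectedPartition_pair_of_odd (completeSunGraph_one_adj_inl_inr n)
      (completeSunGraph_one_not_adj_inr n) ha ha2 hb2
  refine ⟨fun h => ?_, fun h => ?_, ?_, ?_⟩
  · exact ⟨hsun h.add_one (by omega) (by omega), hcomplete h.add_one (by omega) (by omega)⟩
  · exact ⟨hsun h (by omega) (by omega), hcomplete h (by omega) (by omega)⟩
  · refine not_ePositive_of_pendant hn (sunGraph_one_adj_inl n) (sunGraph_one_adj_inl_inr n)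
      (sunGraph_one_not_adj_inr n) (C := n - 1) (by omega) fun m z hz => ?_
    obtain ⟨N, rfl⟩ : ∃ N, n = N + 1 := ⟨n - 1, by omega⟩
    rw [colouringSum_cycleG z (by omega), Nat.add_sub_cancel,
      show (-1 : ℂ) ^ (N + 1 + 1) = (-1) ^ N by ring]
    convert trace_pow_of_powerSum_eq_zero z (N := N) (by omega)
      fun k hk hkN => hz k hk (by omega)
  · refine not_ePositive_of_pendant hn (completeSunGraph_one_adj_inl n)
      (completeSunGraph_one_adj_inl_inr n) (completeSunGraph_one_not_adj_inr n)
      (C := (n - 1).factorial) (Nat.factorial_pos _) fun m z hz => ?_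
    rw [colouringSum_top, ← Nat.mul_factorial_pred (by omega : n ≠ 0), Nat.cast_mul, mul_right_comm,
      mul_esymm_of_powerSum_eq_zero z hn hz]
    ring
end

section
/- Let n ≥ 3 and k ≥ 2. If n(k+1) is even, then neither the sun graph S(n; k) nor the complete sun graph S̄(n; k) (each having n(k+1) vertices) admits a connected partition of type (n(k+1)/2 + 1, n(k+1)/2 − 1); if n(k+1) is odd, neither admits a connected partition of type ((n(k+1)+1)/2, (n(k+1)−1)/2). Consequently S(n; k) and S̄(n; k) are not e-positive. -/
open Classical in
/-- Sum, over the colourings that are constant on the fibres of `π` and proper along the edges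
in `L`, of the product of the weights of the colours. -/
noncomputable def weightSum {V ι R : Type*} [Fintype V] [Fintype ι] [CommRing R] (y : ι → R)
    (L : List (V × V)) (π : V → V) : R :=
  ∑ κ : V → ι with (∀ u v, π u = π v → κ u = κ v) ∧ ∀ e ∈ L, κ e.1 ≠ κ e.2, ∏ v, y (κ v)

open Classical in
/-- Merge the fibres of `π` over the ends of the edge `e`. -/
noncomputable def contractEdge {V : Type*} (e : V × V) (π : V → V) : V → V :=
  fun x => if π x = π e.1 then π e.2 else π x

/-- The edges in `L` connect the fibres of `π`. -/
def ConnectsFibres {V : Type*} (L : List (V × V)) (π : V → V) : Prop :=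
  ∀ P : V → Prop, (∀ x y, π x = π y → (P x ↔ P y)) → (∀ e ∈ L, P e.1 ↔ P e.2) →
    ∀ x y, P x ↔ P y

lemma contractEdge_eq {V : Type*} {e : V × V} {π : V → V} {u v : V} (h : π u = π v) :
    contractEdge e π u = contractEdge e π v := by
  unfold contractEdge
  rw [h]

lemma contractEdge_ends {V : Type*} (e : V × V) (π : V → V) :
    contractEdge e π e.1 = contractEdge e π e.2 := by
  simp [contractEdge]

lemma contractEdge_eq_iff {V α : Type*} {e : V × V} {π : V → V} {κ : V → α} :
    (∀ u v, contractEdge e π u = contractEdge e π v → κ u = κ v) ↔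
      (∀ u v, π u = π v → κ u = κ v) ∧ κ e.1 = κ e.2 := by
  refine ⟨fun h => ⟨fun u v huv => h u v (contractEdge_eq huv), h _ _ (contractEdge_ends e π)⟩, ?_⟩
  rintro ⟨h, he⟩ u v huv
  unfold contractEdge at huv
  split_ifs at huv with h1 h2 h2
  · exact h _ _ (h1.trans h2.symm)
  · rw [h _ _ h1, he, h _ _ huv]
  · rw [h _ _ h2, he, h _ _ huv]
  · exact h _ _ huv

lemma ConnectsFibres.contractEdge {V : Type*} {e : V × V} {L : List (V × V)} {π : V → V}
    (h : ConnectsFibres (e :: L) π) : ConnectsFibres L (contractEdge e π) := fun P hP hL =>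
  h P (fun x y hxy => hP x y (contractEdge_eq hxy))
    (List.forall_mem_cons.2 ⟨hP _ _ (contractEdge_ends e π), hL⟩)

section weightSum

variable {V ι R : Type*} [Fintype V] [Fintype ι] [CommRing R] (y : ι → R)

lemma weightSum_cons (e : V × V) (L : List (V × V)) (π : V → V) :
    weightSum y (e :: L) π = weightSum y L π - weightSum y L (contractEdge e π) := by
  classical
  rw [eq_sub_iff_add_eq]
  unfold weightSum
  rw [← Finset.sum_filter_add_sum_filter_not (Finset.univ.filter fun κ : V → ι =>
    (∀ u v, π u = π v → κ u = κ v) ∧ ∀ e ∈ L, κ e.1 ≠ κ e.2) (fun κ => κ e.1 ≠ κ e.2)]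
  rw [Finset.filter_filter, Finset.filter_filter]
  congr 1 <;> refine Finset.sum_congr (Finset.filter_congr fun κ _ => ?_) fun _ _ => rfl
  · simp only [List.forall_mem_cons]
    tauto
  · rw [contractEdge_eq_iff]
    tauto

open Classical in
lemma weightSum_nil (π : V → V) :
    weightSum y [] π = ∏ c ∈ Finset.univ.image π, ∑ i, y i ^ {v | π v = c}.ncard := by
  have hc : ∀ c, {v | π v = c}.ncard = (Finset.univ.filter fun v => π v = c).card := fun c => by
    rw [← Set.ncard_coe_finset]; simp
  simp only [hc, Finset.prod_sum]
  unfold weightSum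
  symm
  refine Finset.sum_bij (fun σ _ v => σ (π v) (Finset.mem_image_of_mem _ (Finset.mem_univ v)))
    ?_ ?_ ?_ ?_
  · intro σ _
    simp only [List.not_mem_nil, false_imp_iff, implies_true, and_true, Finset.mem_filter,
      Finset.mem_univ, true_and]
    intro u v huv
    congr
  · intro σ _ τ _ h
    funext c hc
    obtain ⟨v, -, rfl⟩ := Finset.mem_image.1 hc
    exact congrFun h v
  · intro κ hκ
    have hκ := (Finset.mem_filter.1 hκ).2.1
    refine ⟨fun c hc => κ (Finset.mem_image.1 hc).choose, by simp, ?_⟩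
    funext v
    exact hκ _ _ (Finset.mem_image.1 (Finset.mem_image_of_mem π (Finset.mem_univ v))).choose_spec.2
  · intro σ _
    rw [← Finset.prod_fiberwise_of_maps_to (t := Finset.univ.image π) (g := π)
      (fun v _ => Finset.mem_image_of_mem _ (Finset.mem_univ v))
      (fun v => y (σ (π v) (Finset.mem_image_of_mem _ (Finset.mem_univ v)))),
      ← Finset.prod_attach (Finset.univ.image π) (fun c => ∏ v with π v = c, _)]
    refine Finset.prod_congr rfl fun c _ => ?_
    rw [Finset.prod_congr rfl (g := fun _ => y (σ c.1 c.2))]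
    · simp
    · intro v hv
      have : π v = c.1 := (Finset.mem_filter.1 hv).2
      congr

/-- If every power-sum product indexed by a partition into connected fibres vanishes, then so
does the weighted count of proper colourings. -/
lemma weightSum_eq_zero (good : (V → V) → Prop)
    (hnil : ∀ π, good π → weightSum y [] π = 0) (L : List (V × V))
    (hstep : ∀ e ∈ L, ∀ π, good π → good (contractEdge e π)) :
    ∀ π, good π → weightSum y L π = 0 := by
  induction L with
  | nil => exact hnil
  | cons e L ih =>
    intro π hπ
    have ih := ih fun e he => hstep e (List.mem_cons_of_mem _ he)
    rw [weightSum_cons, ih π hπ, ih _ (hstep e List.mem_cons_self π hπ), sub_zero]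

open Classical in
lemma card_image_contractEdge {e : V × V} {π : V → V} (he : π e.1 ≠ π e.2) :
    (Finset.univ.image (contractEdge e π)).card + 1 = (Finset.univ.image π).card := by
  have : Finset.univ.image (contractEdge e π) = (Finset.univ.image π).erase (π e.1) := by
    ext c
    simp only [Finset.mem_image, Finset.mem_univ, true_and, Finset.mem_erase, contractEdge]
    constructor
    · rintro ⟨x, rfl⟩
      split_ifs with h
      · exact ⟨he.symm, e.2, rfl⟩
      · exact ⟨h, x, rfl⟩
    · rintro ⟨h, x, rfl⟩
      exact ⟨x, if_neg h⟩
  rw [this, Finset.card_erase_add_one (Finset.mem_image_of_mem _ (Finset.mem_univ _))]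

open Classical in
/-- If the only nonvanishing power sum of degree at most `|V|` is the one of degree `|V|`, which is
a positive integer, the weighted count of proper colourings has a definite sign. -/
lemma weightSum_sign [Nonempty V]
    (hy : ∀ j, 0 < j → j < Fintype.card V → ∑ i, y i ^ j = 0) {N : ℕ} (hN : 0 < N)
    (hyN : ∑ i, y i ^ Fintype.card V = N) (L : List (V × V)) : ∀ π : V → V,
    ∃ m : ℕ, weightSum y L π * (-1) ^ ((Finset.univ.image π).card + 1) = m ∧
      (ConnectsFibres L π → (∀ e ∈ L, π e.1 ≠ π e.2) → 0 < m) := by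
  induction L with
  | nil =>
    intro π
    obtain ⟨x₀⟩ := ‹Nonempty V›
    by_cases hπ : ∀ x, π x = π x₀
    · have himg : Finset.univ.image π = {π x₀} := by
        ext c
        simp only [Finset.mem_image, Finset.mem_univ, true_and, Finset.mem_singleton, hπ,
          exists_const_iff, eq_comm (a := c)]
        exact ⟨fun h => h.2, fun h => ⟨⟨x₀⟩, h⟩⟩
      refine ⟨N, ?_, fun _ _ => hN⟩
      rw [weightSum_nil, himg]
      simp [hπ, Set.ncard_univ, hyN]
    · refine ⟨0, ?_, fun h => (hπ fun x => ?_).elim⟩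
      · push Not at hπ
        obtain ⟨x, hx⟩ := hπ
        have : weightSum y [] π = 0 := by
          rw [weightSum_nil]
          refine Finset.prod_eq_zero (Finset.mem_image_of_mem π (Finset.mem_univ x)) (hy _ ?_ ?_)
          · exact (Set.ncard_pos).2 ⟨x, rfl⟩
          · rw [← Nat.card_eq_fintype_card, ← Set.ncard_univ]
            exact Set.ncard_lt_ncard
              (Set.ssubset_univ_iff.2 fun h => hx (h.symm ▸ Set.mem_univ x₀ :
                x₀ ∈ {v | π v = π x}).symm)
        simp [this]
      · exact (h (fun z => π z = π x₀) (by simp +contextual) (by simp) x x₀).2 rfl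
  | cons e L ih =>
    intro π
    rw [weightSum_cons]
    by_cases he : π e.1 = π e.2
    · have : contractEdge e π = π := by
        funext x
        unfold contractEdge
        split_ifs with h
        · rw [h, he]
        · rfl
      exact ⟨0, by simp [this], fun _ h => (h e List.mem_cons_self he).elim⟩
    · obtain ⟨m, hm, hpos⟩ := ih π
      obtain ⟨m', hm', hpos'⟩ := ih (contractEdge e π)
      refine ⟨m + m', ?_, fun hconn hloop => ?_⟩
      · rw [← card_image_contractEdge he] at hm ⊢
        push_cast
        rw [← hm, ← hm']
        ring
      · by_cases hpar : ∀ e' ∈ L, contractEdge e π e'.1 ≠ contractEdge e π e'.2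
        · exact Nat.add_pos_right _ (hpos' hconn.contractEdge hpar)
        · push Not at hpar
          obtain ⟨e', he', hpar⟩ := hpar
          refine Nat.add_pos_left (hpos ?_ fun f hf => hloop f (List.mem_cons_of_mem _ hf)) _
          intro P hP hL
          refine hconn P hP (List.forall_mem_cons.2 ⟨?_, hL⟩)
          have hne := hloop e' (List.mem_cons_of_mem _ he')
          have hPe := hL e' he'
          unfold contractEdge at hpar
          split_ifs at hpar with h1 h2 h2
          · exact (hne (h1.trans h2.symm)).elim
          · rw [← hP _ _ h1, hPe, hP _ _ hpar]
          · rw [← hP _ _ h2, ← hPe, hP _ _ hpar]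
          · exact (hne hpar).elim

end weightSum

section Specialization

variable (N : ℕ) (y : ℕ → ℂ)

/-- `φ` is the substitution `x_i ↦ y_i T` for `i < N` and `x_i ↦ 0` for `i ≥ N`, described through
the coefficients of its values. -/
def IsSpecialization (φ : MvPowerSeries ℕ ℚ →ₐ[ℚ] PowerSeries ℂ) : Prop := ∀ f m,
  PowerSeries.coeff m (φ f) = ∑ d ∈ Finset.finsuppAntidiag (Finset.range N) m,
    ((MvPowerSeries.coeff d f : ℚ) : ℂ) * ∏ i ∈ Finset.range N, y i ^ d i

/-- The substitution `x_i ↦ y_i T` for `i < N` and `x_i ↦ 0` for `i ≥ N`. -/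
lemma exists_specialization : ∃ φ : MvPowerSeries ℕ ℚ →ₐ[ℚ] PowerSeries ℂ, IsSpecialization N y φ := by
  classical
  let a : ℕ → MvPowerSeries Unit ℂ := fun i =>
    if i < N then PowerSeries.C (y i) * PowerSeries.X else (0 : PowerSeries ℂ)
  have ha : MvPowerSeries.HasSubst a := by
    constructor
    · intro i
      simp only [a]
      split_ifs
      · have : PowerSeries.constantCoeff (PowerSeries.C (y i) * PowerSeries.X) = 0 := by simp
        exact ⟨1, by rw [pow_one]; exact this⟩
      · simp
    · intro d
      refine (Set.finite_Iio N).subset fun i hi => ?_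
      by_contra h
      exact hi (by simp only [a]; rw [if_neg (show ¬ i < N from h)]; simp)
  refine ⟨MvPowerSeries.substAlgHom ha, fun f m => ?_⟩
  have hmon : ∀ d : ℕ →₀ ℕ,
      PowerSeries.coeff m (d.prod fun s e => a s ^ e : PowerSeries ℂ) =
      if d ∈ Finset.finsuppAntidiag (Finset.range N) m
        then ∏ i ∈ Finset.range N, y i ^ d i else 0 := by
    intro d
    by_cases hd : d.support ⊆ Finset.range N
    · have h1 : (d.prod fun s e => a s ^ e : PowerSeries ℂ) =
          PowerSeries.C (∏ i ∈ Finset.range N, y i ^ d i) *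
            PowerSeries.X ^ (∑ i ∈ Finset.range N, d i) := by
        rw [Finsupp.prod_of_support_subset _ hd _ (by simp), map_prod,
          ← Finset.prod_pow_eq_pow_sum, ← Finset.prod_mul_distrib]
        refine Finset.prod_congr rfl fun i hi => ?_
        simp only [a]
        rw [if_pos (Finset.mem_range.1 hi), map_pow]
        exact mul_pow _ _ _
      rw [h1, PowerSeries.coeff_C_mul, PowerSeries.coeff_X_pow]
      simp [Finset.mem_finsuppAntidiag, hd, eq_comm]
    · rw [if_neg fun h => hd (Finset.mem_finsuppAntidiag.1 h).2]
      obtain ⟨i, hi, hiN⟩ := Finset.not_subset.1 hd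
      have : (d.prod fun s e => a s ^ e : PowerSeries ℂ) = 0 := by
        refine Finset.prod_eq_zero hi ?_
        simp only [a]
        rw [if_neg fun h => hiN (Finset.mem_range.2 h)]
        exact zero_pow (Finsupp.mem_support_iff.1 hi)
      rw [this, map_zero]
  rw [MvPowerSeries.substAlgHom_apply]
  refine (MvPowerSeries.coeff_subst ha f _).trans ?_
  change (finsum fun d => MvPowerSeries.coeff d f •
    PowerSeries.coeff m (d.prod fun s e => a s ^ e : PowerSeries ℂ)) = _
  rw [finsum_eq_sum_of_support_subset (s := Finset.finsuppAntidiag (Finset.range N) m)]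
  · refine Finset.sum_congr rfl fun d hd => ?_
    rw [hmon, if_pos hd, Rat.smul_def]
  · intro d hd
    by_contra h
    exact hd (by dsimp only; rw [hmon, if_neg (mt Finset.mem_coe.2 h), smul_zero])

variable {N y} {φ : MvPowerSeries ℕ ℚ →ₐ[ℚ] PowerSeries ℂ}

lemma specialization_esym (hφ : IsSpecialization N y φ) (j : ℕ) :
    φ (esym j) = PowerSeries.C (((Finset.range N).val.map y).esymm j) * PowerSeries.X ^ j := by
  classical
  ext m
  rw [hφ, PowerSeries.coeff_C_mul, PowerSeries.coeff_X_pow, Finset.esymm_map_val, mul_ite, mul_one,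
    mul_zero]
  have hsum : ∀ d ∈ Finset.finsuppAntidiag (Finset.range N) m, (d.sum fun _ v => v) = m := by
    intro d hd
    obtain ⟨h1, h2⟩ := Finset.mem_finsuppAntidiag.1 hd
    rw [← h1]
    exact Finsupp.sum_of_support_subset _ h2 _ (by simp)
  have hcoeff : ∀ d : ℕ →₀ ℕ, MvPowerSeries.coeff d (esym j) =
      if (∀ i ∈ d.support, d i = 1) ∧ (d.sum fun _ v => v) = j then 1 else 0 := fun d => rfl
  split_ifs with hm
  · subst hm
    simp only [hcoeff, apply_ite (Rat.cast : ℚ → ℂ), Rat.cast_one, Rat.cast_zero, ite_mul, one_mul,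
      zero_mul]
    rw [← Finset.sum_filter]
    refine Finset.sum_bij' (fun d _ => d.support) (fun s _ => Finsupp.indicator s fun _ _ => 1)
      ?_ ?_ ?_ ?_ ?_
    · intro d hd
      obtain ⟨hd, h1, h2⟩ := Finset.mem_filter.1 hd
      refine Finset.mem_powersetCard.2 ⟨(Finset.mem_finsuppAntidiag.1 hd).2, ?_⟩
      rw [← h2, Finsupp.sum, Finset.sum_congr rfl h1, Finset.card_eq_sum_ones]
    · intro s hs
      obtain ⟨hs, hc⟩ := Finset.mem_powersetCard.1 hs
      have hmem : (Finsupp.indicator s fun _ _ => 1) ∈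
          Finset.finsuppAntidiag (Finset.range N) m := by
        refine Finset.mem_finsuppAntidiag.2 ⟨?_, (Finsupp.support_indicator_subset _ _).trans hs⟩
        simp [Finsupp.indicator_apply, Finset.inter_eq_right.2 hs, hc]
      refine Finset.mem_filter.2 ⟨hmem, fun i hi => ?_, hsum _ hmem⟩
      have := Finsupp.support_indicator_subset _ _ hi
      simp_all [Finsupp.indicator_apply]
    · intro d hd
      obtain ⟨hd, h1, h2⟩ := Finset.mem_filter.1 hd
      ext i
      by_cases hi : i ∈ d.support
      · simp [Finsupp.indicator_apply, h1 i hi]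
      · simp_all [Finsupp.indicator_apply]
    · intro s hs
      ext i
      simp [Finsupp.indicator_apply]
    · intro d hd
      obtain ⟨hd, h1, h2⟩ := Finset.mem_filter.1 hd
      rw [← Finset.prod_subset (Finset.mem_finsuppAntidiag.1 hd).2]
      · exact Finset.prod_congr rfl fun i hi => by rw [h1 i hi, pow_one]
      · intro i _ hi
        rw [Finsupp.notMem_support_iff.1 hi, pow_zero]
  · refine Finset.sum_eq_zero fun d hd => ?_
    rw [hcoeff, if_neg fun h => hm ((hsum d hd).symm.trans h.2), Rat.cast_zero, zero_mul]

lemma specialization_esymM (hφ : IsSpecialization N y φ) (μ : Multiset ℕ) :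
    φ (esymM μ) = PowerSeries.C (μ.map ((Finset.range N).val.map y).esymm).prod *
      PowerSeries.X ^ μ.sum := by
  induction μ using Multiset.induction_on with
  | empty => simp [esymM]
  | cons j μ ih =>
    have : esymM (j ::ₘ μ) = esym j * esymM μ := by simp [esymM]
    rw [this, map_mul, ih, specialization_esym hφ, Multiset.map_cons, Multiset.prod_cons,
      Multiset.sum_cons, map_mul, pow_add]
    ring

open Classical in
lemma coeff_specialization_of_eq_sum (hφ : IsSpecialization N y φ) (c : Multiset ℕ →₀ ℚ) (n : ℕ) :
    PowerSeries.coeff n (φ (c.sum fun μ a => a • esymM μ)) =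
      ∑ μ ∈ c.support with μ.sum = n,
        (c μ : ℂ) * (μ.map ((Finset.range N).val.map y).esymm).prod := by
  rw [Finsupp.sum, map_sum, map_sum, Finset.sum_filter]
  refine Finset.sum_congr rfl fun μ _ => ?_
  rw [map_smul, specialization_esymM hφ, PowerSeries.coeff_smul, PowerSeries.coeff_C_mul,
    PowerSeries.coeff_X_pow, Rat.smul_def, mul_ite, mul_one, mul_zero, mul_ite, mul_zero]
  simp only [eq_comm]

lemma coeff_specialization_csf (hφ : IsSpecialization N y φ) {V : Type} [Fintype V]
    (G : SimpleGraph V) (L : List (V × V)) (hL : ∀ u v, (u, v) ∈ L ↔ G.Adj u v) :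
    PowerSeries.coeff (Fintype.card V) (φ (csf G)) = weightSum (fun i : Fin N => y i) L id := by
  classical
  have hproper : ∀ κ : V → Fin N,
      ((∀ u v, id u = id v → κ u = κ v) ∧ ∀ e ∈ L, κ e.1 ≠ κ e.2) ↔
        ∀ u v, G.Adj u v → κ u ≠ κ v := fun κ => by
    simp only [Prod.forall, hL, id]
    exact ⟨fun h => h.2, fun h => ⟨fun u v huv => huv ▸ rfl, h⟩⟩
  let T : (V → ℕ) → ℕ →₀ ℕ := fun κ => ∑ v, Finsupp.single (κ v) 1
  have hT : ∀ κ i, T κ i = Nat.card {v // κ v = i} := fun κ i => by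
    simp [T, Finsupp.finsetSum_apply, Finsupp.single_apply, Fintype.card_subtype]
  have hmem : ∀ κ : V → Fin N, T (fun v => κ v) ∈
      Finset.finsuppAntidiag (Finset.range N) (Fintype.card V) := fun κ => by
    refine Finset.mem_finsuppAntidiag.2 ⟨?_, fun i hi => ?_⟩
    · simp only [T, Finsupp.finsetSum_apply]
      rw [Finset.sum_comm]
      simp [Finsupp.single_apply]
    · rw [Finsupp.mem_support_iff, hT, Nat.card_ne_zero] at hi
      obtain ⟨⟨v, rfl⟩⟩ := hi.1
      simp
  have hprod : ∀ κ : V → Fin N,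
      ∏ v, y (κ v) = ∏ i ∈ Finset.range N, y i ^ T (fun v => κ v) i := fun κ => by
    simp only [T, Finsupp.finsetSum_apply, ← Finset.prod_pow_eq_pow_sum]
    rw [Finset.prod_comm]
    refine Finset.prod_congr rfl fun v _ => ?_
    rw [Finset.prod_eq_single_of_mem (κ v : ℕ) (by simp)]
    · simp
    · intro i _ hi
      simp [hi.symm]
  have hsum : weightSum (fun i : Fin N => y i) L id =
      ∑ κ : V → Fin N with (∀ u v, G.Adj u v → κ u ≠ κ v), ∏ v, y (κ v) :=
    Finset.sum_congr (by ext κ; simp only [Finset.mem_filter, hproper]) fun _ _ => rfl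
  rw [hφ, hsum, ← Finset.sum_fiberwise_of_maps_to (g := fun κ : V → Fin N => T fun v => κ v)
      (fun κ _ => hmem κ) _]
  refine Finset.sum_congr rfl fun d hd => ?_
  rw [Finset.sum_congr rfl (g := fun _ => ∏ i ∈ Finset.range N, y i ^ d i) fun κ hκ => by
      rw [hprod, (Finset.mem_filter.1 hκ).2], Finset.sum_const, nsmul_eq_mul]
  congr 1
  have hcoeff : MvPowerSeries.coeff d (csf G) = (Nat.card {κ : V → ℕ //
      (∀ u v : V, G.Adj u v → κ u ≠ κ v) ∧ ∀ i : ℕ, Nat.card {v : V // κ v = i} = d i} : ℚ) := rfl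
  rw [hcoeff, Rat.cast_natCast, Nat.cast_inj, ← Set.ncard_coe_finset,
    ← Set.ncard_image_of_injective _
      (f := fun (κ : V → Fin N) (v : V) => (κ v : ℕ))
      fun κ κ' h => funext fun v => Fin.ext (congrFun h v)]
  change Set.ncard _ = _
  congr 1
  ext κ
  simp only [Set.mem_ofPred_eq, Set.mem_image, Finset.coe_filter, Finset.mem_filter, Finset.mem_univ,
    true_and]
  constructor
  · rintro ⟨h1, h2⟩
    have hlt : ∀ v, κ v < N := fun v => by
      refine Finset.mem_range.1 ((Finset.mem_finsuppAntidiag.1 hd).2 ?_)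
      rw [Finsupp.mem_support_iff, ← h2, Nat.card_ne_zero]
      exact ⟨⟨⟨v, rfl⟩⟩, inferInstance⟩
    refine ⟨fun v => ⟨κ v, hlt v⟩, ⟨fun u v huv h => h1 u v huv (Fin.ext_iff.1 h), ?_⟩, rfl⟩
    ext i
    rw [hT, ← h2]
  · rintro ⟨σ, ⟨h1, h2⟩, rfl⟩
    exact ⟨fun u v huv h => h1 u v huv (Fin.ext h), fun i => by rw [← h2, hT]⟩

end Specialization

section ConnectedPartition

variable {V : Type} [Fintype V] [DecidableEq V] {G : SimpleGraph V}

lemma hasConnectedPartition_pair_iff {a b : ℕ} :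
    HasConnectedPartition G {a, b} ↔ ∃ A : Finset V, (G.induce (A : Set V)).Connected ∧
      (G.induce ((Aᶜ : Finset V) : Set V)).Connected ∧ A.card = a ∧ Aᶜ.card = b := by
  constructor
  · rintro ⟨P, hconn, hcard⟩
    have h2 : P.parts.card = 2 := by
      have := congrArg Multiset.card hcard
      simpa using this
    obtain ⟨p, q, hpq, hparts⟩ := Finset.card_eq_two.1 h2
    have hp : p ∈ P.parts := by simp [hparts]
    have hq : q ∈ P.parts := by simp [hparts]
    have hcompl : q = pᶜ := by
      refine (IsCompl.compl_eq ⟨P.disjoint hp hq hpq, ?_⟩).symm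
      have := P.sup_parts
      rw [hparts, Finset.sup_insert, Finset.sup_singleton] at this
      exact codisjoint_iff.2 this
    have hab : ({p.card, q.card} : Multiset ℕ) = {a, b} := by
      rw [← hcard, hparts, Finset.insert_val_of_notMem (by simpa using hpq)]
      simp
    have hcases : p.card = a ∧ q.card = b ∨ p.card = b ∧ q.card = a := by
      have hpm : p.card ∈ ({a, b} : Multiset ℕ) := by rw [← hab]; simp
      rcases Multiset.mem_cons.1 hpm with h | h
      · subst h
        exact .inl ⟨rfl, by simpa using hab⟩
      · rw [Multiset.mem_singleton] at h
        subst h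
        rw [Multiset.pair_comm a] at hab
        exact .inr ⟨rfl, by simpa using hab⟩
    rcases hcases with ⟨h1, h2⟩ | ⟨h1, h2⟩
    · exact ⟨p, hconn p hp, hcompl ▸ hconn q hq, h1, hcompl ▸ h2⟩
    · refine ⟨q, hconn q hq, ?_, h2, ?_⟩ <;> rw [hcompl, compl_compl]
      · exact hconn p hp
      · exact h1
  · rintro ⟨A, hA, hA', rfl, rfl⟩
    have hne : A.Nonempty := by
      obtain ⟨x, hx⟩ := hA.nonempty
      exact ⟨x, hx⟩
    have hne' : Aᶜ.Nonempty := by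
      obtain ⟨x, hx⟩ := hA'.nonempty
      exact ⟨x, hx⟩
    have hAA' : A ≠ Aᶜ := fun h => by
      obtain ⟨x, hx⟩ := hne
      exact Finset.mem_compl.1 (h ▸ hx) hx
    refine ⟨⟨{A, Aᶜ}, ?_, ?_, ?_⟩, ?_, ?_⟩
    · exact (Finset.supIndep_pair hAA').2 disjoint_compl_right
    · simp
    · simp [hne.ne_empty.symm, hne'.ne_empty.symm]
    · simpa [hA] using hA'
    · rw [Finset.insert_val_of_notMem (by simpa using hAA')]
      simp

lemma SimpleGraph.Connected.iff_of_forall_adj {V : Type*} {G : SimpleGraph V} {A : Set V}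
    (hA : (G.induce A).Connected) (P : V → Prop)
    (hP : ∀ u ∈ A, ∀ v ∈ A, G.Adj u v → (P u ↔ P v)) {u v : V} (hu : u ∈ A) (hv : v ∈ A) :
    P u ↔ P v := by
  obtain ⟨w⟩ := hA.preconnected ⟨u, hu⟩ ⟨v, hv⟩
  suffices ∀ (x y : A) (_ : (G.induce A).Walk x y), P x ↔ P y from this _ _ w
  intro x y w
  induction w with
  | nil => rfl
  | cons h _ ih => exact (hP _ (Subtype.prop _) _ (Subtype.prop _) h).trans ih

/-- The fibres of `π` induce connected subgraphs. -/
def HasConnectedFibres {V : Type*} (G : SimpleGraph V) (π : V → V) : Prop :=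
  ∀ (P : V → Prop) (c : V), (∀ u v, π u = c → π v = c → G.Adj u v → (P u ↔ P v)) →
    ∀ u v, π u = c → π v = c → (P u ↔ P v)

lemma HasConnectedFibres.contractEdge {V : Type*} {G : SimpleGraph V} {π : V → V}
    (h : HasConnectedFibres G π) {e : V × V} (he : G.Adj e.1 e.2) :
    HasConnectedFibres G (contractEdge e π) := by
  intro P c hP u v hu hv
  have hfib : ∀ x y, π x = π y → _root_.contractEdge e π x = c → (P x ↔ P y) := fun x y hxy hx =>
    h P (π x) (fun s t hs ht => hP s t ((contractEdge_eq hs).trans hx)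
      ((contractEdge_eq ht).trans hx)) x y rfl hxy.symm
  have hends : _root_.contractEdge e π e.1 = c → (P e.1 ↔ P e.2) := fun h1 =>
    hP _ _ h1 ((contractEdge_ends e π).symm.trans h1) he
  have huv := hu.trans hv.symm
  unfold _root_.contractEdge at huv
  split_ifs at huv with h1 h2 h2
  · exact hfib _ _ (h1.trans h2.symm) hu
  · rw [hfib _ _ h1 hu, hfib _ _ huv.symm hv, hends ((contractEdge_eq h1.symm).trans hu)]
  · rw [hfib _ _ h2 hv, hfib _ _ huv hu, hends ((contractEdge_eq h2.symm).trans hv)]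
  · exact hfib _ _ huv hu

lemma HasConnectedFibres.induce_connected {V : Type*} {G : SimpleGraph V} {π : V → V}
    (h : HasConnectedFibres G π) {A : Set V} (x : V) (hA : ∀ v, v ∈ A ↔ π v = π x) :
    (G.induce A).Connected := by
  have : Nonempty A := ⟨x, (hA x).2 rfl⟩
  refine ⟨fun u v => ?_⟩
  have := h (fun w => ∃ hw : w ∈ A, (G.induce A).Reachable u ⟨w, hw⟩) (π x) ?_ u v
    ((hA u).1 u.2) ((hA v).1 v.2)
  · exact (this.1 ⟨u.2, .refl _⟩).2
  · intro s t hs ht hst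
    have hadj : (G.induce A).Adj ⟨s, (hA s).2 hs⟩ ⟨t, (hA t).2 ht⟩ := hst
    exact ⟨fun ⟨_, h'⟩ => ⟨_, h'.trans hadj.reachable⟩,
      fun ⟨_, h'⟩ => ⟨_, h'.trans hadj.symm.reachable⟩⟩

/-- A partition of `a + b` all of whose parts are multiples of `a` or `b` is `(a, b)`. -/
lemma hasConnectedPartition_of_fibres {a b : ℕ} (hb : 0 < b) (hba : b < a) (hdvd : ¬ b ∣ a)
    (hV : Fintype.card V = a + b) {π : V → V} (h : HasConnectedFibres G π)
    (hfib : ∀ x, a ∣ {v | π v = π x}.ncard ∨ b ∣ {v | π v = π x}.ncard) :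
    HasConnectedPartition G {a, b} := by
  have hnc : ∀ c, {v | π v = c}.ncard = (Finset.univ.filter fun v => π v = c).card := fun c => by
    rw [← Set.ncard_coe_finset]; simp
  simp only [hnc] at hfib
  have hpos : ∀ x, 0 < (Finset.univ.filter fun v => π v = π x).card := fun x =>
    Finset.card_pos.2 ⟨x, by simp⟩
  obtain ⟨x, hx⟩ : ∃ x, ¬ b ∣ (Finset.univ.filter fun v => π v = π x).card := by
    by_contra! hall
    refine hdvd ((Nat.dvd_add_left (dvd_refl b)).1 ?_)
    rw [← hV, ← Finset.card_univ, Finset.card_eq_sum_card_image π]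
    refine Finset.dvd_sum fun c hc => ?_
    obtain ⟨z, -, rfl⟩ := Finset.mem_image.1 hc
    exact hall z
  set A := Finset.univ.filter fun v => π v = π x with hAdef
  have hAA := Finset.card_add_card_compl A
  have hAa : A.card = a := by
    obtain ⟨m, hm⟩ := (hfib x).resolve_right hx
    have := hpos x
    rcases m with _ | _ | m
    · simp_all
    · simpa using hm
    · rw [hV, hm] at hAA
      nlinarith
  have hAb : Aᶜ.card = b := by omega
  obtain ⟨z, hz⟩ : Aᶜ.Nonempty := by
    rwa [← Finset.card_pos, hAb]
  have hsub : (Finset.univ.filter fun v => π v = π z) ⊆ Aᶜ := fun v hv => by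
    simp_all
  have hle := Finset.card_le_card hsub
  have heq : (Finset.univ.filter fun v => π v = π z) = Aᶜ := by
    refine Finset.eq_of_subset_of_card_le hsub ?_
    rcases hfib z with h' | h'
    · have := Nat.le_of_dvd (hpos z) h'
      omega
    · exact hAb ▸ Nat.le_of_dvd (hpos z) h'
  exact hasConnectedPartition_pair_iff.2 ⟨A, h.induce_connected x (by simp [A]),
    h.induce_connected z (by simp [← heq]), hAa, hAb⟩

end ConnectedPartition

section RootsOfUnity

open Polynomial

lemma IsPrimitiveRoot.prod_range_X_sub_C_pow {R : Type*} [CommRing R] [IsDomain R] {ζ : R} {n : ℕ}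
    (hζ : IsPrimitiveRoot ζ n) (hn : 0 < n) :
    ∏ i ∈ Finset.range n, (X - C (ζ ^ i)) = (X ^ n - 1 : R[X]) := by
  classical
  have h := hζ.nthRoots_eq (one_pow n)
  rw [X_pow_sub_one_eq_prod hn hζ, nthRootsFinset, ← Multiset.toFinset_eq hζ.nthRoots_one_nodup]
  change _ = ((nthRoots n 1).map fun ζ => X - C ζ).prod
  rw [h]
  simp [Finset.prod]

lemma IsPrimitiveRoot.sum_range_pow_pow {R : Type*} [CommRing R] [IsDomain R] {ζ : R} {n : ℕ}
    (hζ : IsPrimitiveRoot ζ n) (j : ℕ) :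
    ∑ i ∈ Finset.range n, (ζ ^ i) ^ j = if n ∣ j then (n : R) else 0 := by
  simp only [← pow_mul, mul_comm _ j]
  simp only [pow_mul]
  split_ifs with h
  · simp [(hζ.pow_eq_one_iff_dvd j).2 h]
  · have h1 : ζ ^ j ≠ 1 := fun h' => h ((hζ.pow_eq_one_iff_dvd j).1 h')
    have h2 := geom_sum_mul (ζ ^ j) n
    rw [pow_right_comm, hζ.pow_eq_one, one_pow, sub_self] at h2
    exact (mul_eq_zero.1 h2).resolve_right (sub_ne_zero.2 h1)

lemma Finset.esymm_eq_coeff_prod_X_sub_C {R : Type*} [CommRing R] {N j : ℕ} (y : ℕ → R)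
    (hj : j ≤ N) : ((Finset.range N).val.map y).esymm j =
      (-1) ^ j * (∏ i ∈ Finset.range N, (X - C (y i))).coeff (N - j) := by
  have h := Multiset.prod_X_sub_C_coeff ((Finset.range N).val.map y) (k := N - j) (by simp)
  simp only [Multiset.card_map, Finset.card_val, Finset.card_range, Nat.sub_sub_self hj,
    Multiset.map_map, Function.comp_def] at h
  rw [Finset.prod, h, ← mul_assoc, ← mul_pow]
  simp

/-- The `a`-th roots of unity followed by the `b`-th roots of unity. -/
noncomputable def twoRoots (a b : ℕ) : ℕ → ℂ := fun i =>
  if i < a then Complex.exp (2 * Real.pi * Complex.I / a) ^ i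
  else Complex.exp (2 * Real.pi * Complex.I / b) ^ (i - a)

lemma sum_twoRoots_pow {a b : ℕ} (ha : a ≠ 0) (hb : b ≠ 0) (j : ℕ) :
    ∑ i ∈ Finset.range (a + b), twoRoots a b i ^ j =
      (if a ∣ j then (a : ℂ) else 0) + if b ∣ j then (b : ℂ) else 0 := by
  rw [Finset.sum_range_add, ← (Complex.isPrimitiveRoot_exp a ha).sum_range_pow_pow,
    ← (Complex.isPrimitiveRoot_exp b hb).sum_range_pow_pow]
  congr 1 <;> refine Finset.sum_congr rfl fun i hi => ?_
  · simp [twoRoots, Finset.mem_range.1 hi]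
  · simp [twoRoots]

lemma prod_X_sub_C_twoRoots {a b : ℕ} (ha : 0 < a) (hb : 0 < b) :
    ∏ i ∈ Finset.range (a + b), (X - C (twoRoots a b i)) = (X ^ a - 1) * (X ^ b - 1) := by
  rw [Finset.prod_range_add, ← (Complex.isPrimitiveRoot_exp a ha.ne').prod_range_X_sub_C_pow ha,
    ← (Complex.isPrimitiveRoot_exp b hb.ne').prod_range_X_sub_C_pow hb]
  congr 1 <;> refine Finset.prod_congr rfl fun i hi => ?_
  · simp only [twoRoots, Finset.mem_range.1 hi, if_true]
  · simp [twoRoots]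

lemma esymm_twoRoots {a b j : ℕ} (hb : 0 < b) (hba : b < a) (hj : 0 < j) (hj' : j ≤ a + b) :
    ((Finset.range (a + b)).val.map (twoRoots a b)).esymm j =
      (-1) ^ j * if j = a + b then 1 else if j = a ∨ j = b then -1 else 0 := by
  rw [Finset.esymm_eq_coeff_prod_X_sub_C _ hj', prod_X_sub_C_twoRoots (hb.trans hba) hb]
  have : ((X ^ a - 1) * (X ^ b - 1) : ℂ[X]) = X ^ (a + b) - X ^ a - X ^ b + 1 := by ring
  rw [this]
  simp only [coeff_add, coeff_sub, coeff_X_pow, coeff_one]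
  congr 1
  split_ifs <;> first | omega | simp

lemma esymm_rootsOfUnity {N j : ℕ} {ζ : ℂ} (hζ : IsPrimitiveRoot ζ N) (hj : 0 < j) (hj' : j < N) :
    ((Finset.range N).val.map (ζ ^ ·)).esymm j = 0 := by
  rw [Finset.esymm_eq_coeff_prod_X_sub_C _ hj'.le, hζ.prod_range_X_sub_C_pow (by omega)]
  simp only [coeff_sub, coeff_X_pow, coeff_one]
  rw [if_neg (by omega), if_neg (by omega)]
  simp

end RootsOfUnity

section EPositivity

lemma Multiset.lt_sum_of_zero_notMem {μ : Multiset ℕ} (h0 : 0 ∉ μ) (hμ : μ ≠ {μ.sum})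
    {j : ℕ} (hj : j ∈ μ) : 0 < j ∧ j < μ.sum := by
  obtain ⟨ν, rfl⟩ := Multiset.exists_cons_of_mem hj
  rw [Multiset.sum_cons] at hμ ⊢
  refine ⟨Nat.pos_of_ne_zero fun h => h0 (h ▸ hj), Nat.lt_add_of_pos_right ?_⟩
  refine Nat.pos_of_ne_zero fun hs => hμ ?_
  rw [Multiset.sum_eq_zero_iff] at hs
  have : ν = 0 := Multiset.eq_zero_of_forall_notMem fun x hx =>
    h0 (Multiset.mem_cons_of_mem (hs x hx ▸ hx))
  simp [this]

lemma Multiset.eq_pair_of_forall_mem {a b : ℕ} (hb : 0 < b) (hba : b < a) (hdvd : ¬ b ∣ a)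
    {μ : Multiset ℕ} (hsum : μ.sum = a + b) (h : ∀ j ∈ μ, j = a ∨ j = b) : μ = {a, b} := by
  have key : ∀ ν : Multiset ℕ, (∀ j ∈ ν, j = b) → ν = Multiset.replicate ν.card b := fun ν hν =>
    Multiset.eq_replicate.2 ⟨rfl, hν⟩
  by_cases ha : a ∈ μ
  · obtain ⟨ν, rfl⟩ := Multiset.exists_cons_of_mem ha
    rw [Multiset.sum_cons, Nat.add_left_cancel_iff] at hsum
    have hν := key ν fun j hj => (h j (Multiset.mem_cons_of_mem hj)).resolve_left fun hja => by
      have := Multiset.le_sum_of_mem hj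
      omega
    rw [hν, Multiset.sum_replicate, smul_eq_mul] at hsum
    rw [hν, show ν.card = 1 by nlinarith]
    rfl
  · have hμ := key μ fun j hj => (h j hj).resolve_left fun hja => ha (hja ▸ hj)
    rw [hμ, Multiset.sum_replicate, smul_eq_mul] at hsum
    exact (hdvd ((Nat.dvd_add_left (dvd_refl b)).1 (hsum ▸ dvd_mul_left _ _))).elim

variable {V : Type} [Fintype V] [Nonempty V] {G : SimpleGraph V}

/-- The coefficient of `e_N` in the chromatic symmetric function of a connected graph on `N`
vertices does not vanish. -/
lemma coeff_singleton_ne_zero_of_csf_eq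
    (hG : ∀ P : V → Prop, (∀ u v, G.Adj u v → (P u ↔ P v)) → ∀ u v, P u ↔ P v)
    {c : Multiset ℕ →₀ ℚ} (h0 : ∀ μ ∈ c.support, 0 ∉ μ)
    (hc : csf G = c.sum fun μ a => a • esymM μ) : c {Fintype.card V} ≠ 0 := by
  classical
  intro hzero
  have hN : 0 < Fintype.card V := Fintype.card_pos
  set N := Fintype.card V with hNdef
  have hζ := Complex.isPrimitiveRoot_exp N hN.ne'
  set ζ := Complex.exp (2 * Real.pi * Complex.I / N)
  obtain ⟨φ, hφ⟩ := exists_specialization N (ζ ^ ·)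
  let L : List (V × V) := (Finset.univ.filter fun e : V × V => G.Adj e.1 e.2).toList
  have hL : ∀ u v, (u, v) ∈ L ↔ G.Adj u v := by simp [L]
  have h1 := coeff_specialization_csf hφ G L hL
  rw [hc, coeff_specialization_of_eq_sum hφ, Finset.sum_eq_zero] at h1
  · have hsum : ∀ j, ∑ i : Fin N, (ζ ^ (i : ℕ)) ^ j = if N ∣ j then (N : ℂ) else 0 := fun j => by
      rw [← hζ.sum_range_pow_pow, Finset.sum_range]
    obtain ⟨m, hm, hpos⟩ := weightSum_sign (V := V) (fun i : Fin N => ζ ^ (i : ℕ))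
      (fun j hj hj' => by rw [hsum, if_neg (Nat.not_dvd_of_pos_of_lt hj hj')])
      hN (by rw [hsum, if_pos dvd_rfl]) L id
    rw [← h1, zero_mul] at hm
    refine (hpos ?_ ?_).ne (by exact_mod_cast hm)
    · exact fun P _ hP => hG P fun u v huv => hP (u, v) ((hL u v).2 huv)
    · exact fun e he => ((hL e.1 e.2).1 he).ne
  · intro μ hμ
    obtain ⟨hμ, hμN⟩ := Finset.mem_filter.1 hμ
    have hne : μ ≠ {μ.sum} := fun h => by
      rw [Finsupp.mem_support_iff, h, hμN] at hμ
      exact hμ hzero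
    obtain ⟨j, hj⟩ : ∃ j, j ∈ μ := Multiset.exists_mem_of_ne_zero fun h => by
      subst h
      simp at hμN
      omega
    obtain ⟨hj0, hjN⟩ := Multiset.lt_sum_of_zero_notMem (h0 μ hμ) hne hj
    have hzero := esymm_rootsOfUnity hζ hj0 (hjN.trans_eq hμN)
    rw [Multiset.prod_eq_zero (Multiset.mem_map.2 ⟨j, hj, hzero⟩), mul_zero]

/-- A connected `e`-positive graph has a connected partition of type `(a, b)`, provided that
`b < a` does not divide `a`. -/
theorem EPositive.hasConnectedPartition [DecidableEq V] (h : EPositive (csf G))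
    (hG : ∀ P : V → Prop, (∀ u v, G.Adj u v → (P u ↔ P v)) → ∀ u v, P u ↔ P v)
    {a b : ℕ} (hb : 0 < b) (hba : b < a) (hdvd : ¬ b ∣ a) (hV : Fintype.card V = a + b) :
    HasConnectedPartition G {a, b} := by
  classical
  by_contra hnot
  obtain ⟨c, hc0, h0, hc⟩ := h
  have hcN : 0 < c {a + b} :=
    lt_of_le_of_ne (hc0 _) (hV ▸ coeff_singleton_ne_zero_of_csf_eq hG h0 hc).symm
  obtain ⟨φ, hφ⟩ := exists_specialization (a + b) (twoRoots a b)
  let L : List (V × V) := (Finset.univ.filter fun e : V × V => G.Adj e.1 e.2).toList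
  have hL : ∀ u v, (u, v) ∈ L ↔ G.Adj u v := by simp [L]
  have h1 := coeff_specialization_csf hφ G L hL
  rw [weightSum_eq_zero _ (HasConnectedFibres G) ?_ L ?_ id ?_, hc,
    coeff_specialization_of_eq_sum hφ, hV] at h1
  · let t : Multiset ℕ → ℚ := fun μ => if μ = {a + b} ∨ μ = {a, b} then 1 else 0
    have ht : ∀ μ ∈ c.support.filter (fun μ => μ.sum = a + b),
        (c μ : ℂ) * (μ.map ((Finset.range (a + b)).val.map (twoRoots a b)).esymm).prod =
          (-1) ^ (a + b) * ((c μ * t μ : ℚ) : ℂ) := by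
      intro μ hμ
      obtain ⟨hμ, hμN⟩ := Finset.mem_filter.1 hμ
      rw [Rat.cast_mul, mul_left_comm]
      congr 1
      by_cases hμ1 : μ = {a + b}
      · subst hμ1
        rw [Multiset.map_singleton, Multiset.prod_singleton, esymm_twoRoots hb hba (by omega) le_rfl]
        simp [t]
      by_cases hμ2 : μ = {a, b}
      · subst hμ2
        have ha' := esymm_twoRoots (j := a) hb hba (by omega) (by omega)
        have hb' := esymm_twoRoots (j := b) hb hba (by omega) (by omega)
        rw [if_neg (by omega), if_pos (.inl rfl)] at ha'
        rw [if_neg (by omega), if_pos (.inr rfl)] at hb'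
        have ht1 : t {a, b} = 1 := if_pos (.inr rfl)
        rw [ht1, Multiset.insert_eq_cons, Multiset.map_cons, Multiset.map_singleton,
          Multiset.prod_cons, Multiset.prod_singleton, ha', hb', Rat.cast_one]
        ring
      · have hlt := fun j hj => Multiset.lt_sum_of_zero_notMem (h0 μ hμ) (hμN ▸ hμ1) (j := j) hj
        obtain ⟨j, hj, hja⟩ : ∃ j ∈ μ, ¬ (j = a ∨ j = b) := by
          by_contra! hall
          exact hμ2 (Multiset.eq_pair_of_forall_mem hb hba hdvd hμN hall)
        rw [hμN] at hlt
        have hj0 : ((Finset.range (a + b)).val.map (twoRoots a b)).esymm j = 0 := by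
          rw [esymm_twoRoots hb hba (hlt j hj).1 (hlt j hj).2.le, if_neg (hlt j hj).2.ne,
            if_neg hja, mul_zero]
        rw [Multiset.prod_eq_zero (Multiset.mem_map.2 ⟨j, hj, hj0⟩)]
        simp only [t, hμ1, hμ2, or_self, if_false, Rat.cast_zero, mul_zero]
    rw [Finset.sum_congr rfl ht, ← Finset.mul_sum, ← Rat.cast_sum, mul_eq_zero,
      or_iff_right (by simp), Rat.cast_eq_zero] at h1
    have hnonneg : ∀ μ ∈ c.support.filter (fun μ => μ.sum = a + b), 0 ≤ c μ * t μ := fun μ _ =>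
      mul_nonneg (hc0 μ) (by simp only [t]; split_ifs <;> norm_num)
    have := (Finset.sum_eq_zero_iff_of_nonneg hnonneg).1 h1 {a + b}
      (Finset.mem_filter.2 ⟨Finsupp.mem_support_iff.2 hcN.ne', by simp⟩)
    simp [t, hcN.ne'] at this
  · intro π hπ
    rw [weightSum_nil]
    by_contra hne
    refine hnot (hasConnectedPartition_of_fibres hb hba hdvd hV hπ fun x => ?_)
    have := Finset.prod_ne_zero_iff.1 hne (π x) (by simp)
    rw [← Finset.sum_range (fun i => twoRoots a b i ^ _),
      sum_twoRoots_pow (by omega) (by omega)] at this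
    by_contra! hno
    exact this (by rw [if_neg hno.1, if_neg hno.2, add_zero])
  · exact fun e he π hπ => hπ.contractEdge ((hL e.1 e.2).1 he)
  · rintro P c - u v rfl rfl
    rfl

end EPositivity

section Sun

variable {n k : ℕ} {body : Fin n → Fin n → Prop}

/-- The body vertex of the ray (together with its root) containing a vertex of a sun graph. -/
def sunIndex {n : ℕ} {lam : Fin n → ℕ} : Fin n ⊕ ((i : Fin n) × Fin (lam i)) → Fin n :=
  Sum.elim id Sigma.fst

lemma sunIndex_eq_of_sunRel {lam : Fin n → ℕ} {u v : Fin n ⊕ ((i : Fin n) × Fin (lam i))}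
    (h : sunRel n lam body u v) (huv : u.isRight ∨ v.isRight) : sunIndex u = sunIndex v := by
  rcases u with i | p <;> rcases v with j | q <;> simp_all [sunRel, sunIndex]

lemma sunIndex_eq_of_adj {lam : Fin n → ℕ} {u v : Fin n ⊕ ((i : Fin n) × Fin (lam i))}
    (h : (SimpleGraph.fromRel (sunRel n lam body)).Adj u v) (huv : u.isRight ∨ v.isRight) :
    sunIndex u = sunIndex v :=
  ((SimpleGraph.fromRel_adj _ _ _).1 h).2.elim (sunIndex_eq_of_sunRel · huv)
    fun h => (sunIndex_eq_of_sunRel h huv.symm).symm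

/-- A connected set of vertices of a sun graph that misses the body is contained in a ray. -/
lemma card_le_of_forall_inl_notMem {A : Finset (Fin n ⊕ ((_ : Fin n) × Fin k))}
    (hA : ((SimpleGraph.fromRel (sunRel n (fun _ => k) body)).induce (A : Set _)).Connected)
    (hbody : ∀ i, Sum.inl i ∉ A) : A.card ≤ k := by
  have hright : ∀ x ∈ A, x.isRight := by
    rintro (i | p) hx
    · exact (hbody i hx).elim
    · rfl
  obtain ⟨x, hx⟩ := hA.nonempty
  have hindex : ∀ y ∈ A, sunIndex y = sunIndex x := fun y hy =>
    (hA.iff_of_forall_adj (fun z => sunIndex z = sunIndex x)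
      (fun u hu v _ huv => by rw [sunIndex_eq_of_adj huv (.inl (hright u hu))]) hy hx).2 rfl
  calc A.card ≤ (Finset.univ.image fun j : Fin k =>
        (Sum.inr ⟨sunIndex x, j⟩ : Fin n ⊕ ((_ : Fin n) × Fin k))).card := by
        refine Finset.card_le_card fun y hy => ?_
        rcases y with i | ⟨i, j⟩
        · exact (hbody i hy).elim
        · have : i = sunIndex x := hindex _ hy
          exact Finset.mem_image.2 ⟨j, Finset.mem_univ _, by rw [this]⟩
    _ ≤ k := Finset.card_image_le.trans_eq (Finset.card_fin k)

lemma card_filter_sunIndex (I : Finset (Fin n)) :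
    (Finset.univ.filter fun x : Fin n ⊕ ((_ : Fin n) × Fin k) => sunIndex x ∈ I).card =
      I.card * (k + 1) := by
  rw [Finset.card_eq_sum_card_fiberwise (f := sunIndex) (t := I) (fun x hx => by simpa using hx),
    Finset.sum_const_nat]
  intro i hi
  have : (Finset.univ.filter fun x : Fin n ⊕ ((_ : Fin n) × Fin k) => sunIndex x ∈ I).filter
      (fun x => sunIndex x = i) =
      insert (Sum.inl i) (Finset.univ.image fun j : Fin k => Sum.inr ⟨i, j⟩) := by
    ext x
    rw [Finset.mem_filter, Finset.mem_filter]
    rcases x with i' | ⟨i', j⟩ <;> simp [sunIndex] <;> aesop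
  rw [this, Finset.card_insert_of_notMem (by simp), Finset.card_image_of_injective, Finset.card_fin]
  exact fun _ _ h => by simpa using h

/-- If a sun graph with rays of order `k` is split into two connected parts, then one of them is
contained in a ray, or both are unions of rays together with their roots. -/
lemma card_of_connected_of_connected_compl {A : Finset (Fin n ⊕ ((_ : Fin n) × Fin k))}
    (hA : ((SimpleGraph.fromRel (sunRel n (fun _ => k) body)).induce (A : Set _)).Connected)
    (hA' : ((SimpleGraph.fromRel (sunRel n (fun _ => k) body)).induce
      ((Aᶜ : Finset _) : Set _)).Connected) :
    A.card ≤ k ∨ Aᶜ.card ≤ k ∨ (k + 1 ∣ A.card ∧ k + 1 ∣ Aᶜ.card) := by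
  by_cases h1 : ∀ i, Sum.inl i ∉ A
  · exact .inl (card_le_of_forall_inl_notMem hA h1)
  by_cases h2 : ∀ i, Sum.inl i ∉ Aᶜ
  · exact .inr (.inl (card_le_of_forall_inl_notMem hA' h2))
  push Not at h1 h2
  -- a connected set containing a body vertex contains the root of each of its vertices
  have key : ∀ B : Finset (Fin n ⊕ ((_ : Fin n) × Fin k)),
      ((SimpleGraph.fromRel (sunRel n (fun _ => k) body)).induce (B : Set _)).Connected →
      (∃ i, Sum.inl i ∈ B) → ∀ x ∈ B, Sum.inl (sunIndex x) ∈ B := by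
    rintro B hB ⟨i, hi⟩ x hx
    by_contra hroot
    have := (hB.iff_of_forall_adj (fun z => sunIndex z = sunIndex x) (fun u hu v hv huv => by
      rcases u with u | u
      · rcases v with v | v
        · exact iff_of_false (fun h => hroot (h ▸ hu)) (fun h => hroot (h ▸ hv))
        · rw [sunIndex_eq_of_adj huv (.inr rfl)]
      · rw [sunIndex_eq_of_adj huv (.inl rfl)]) hi hx).2 rfl
    exact hroot (this ▸ hi)
  have hiff : ∀ x, x ∈ A ↔ Sum.inl (sunIndex x) ∈ A := fun x =>
    ⟨key A hA h1 x, fun h => by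
      by_contra hx
      exact Finset.mem_compl.1 (key _ hA' h2 x (Finset.mem_compl.2 hx)) h⟩
  refine .inr (.inr ⟨?_, ?_⟩)
  · have : A = Finset.univ.filter fun x => sunIndex x ∈ Finset.univ.filter
        fun i : Fin n => Sum.inl i ∈ A := by
      ext x
      simpa using hiff x
    rw [this, card_filter_sunIndex]
    exact dvd_mul_left _ _
  · have : Aᶜ = Finset.univ.filter fun x => sunIndex x ∈ Finset.univ.filter
        fun i : Fin n => Sum.inl i ∉ A := by
      ext x
      simpa using not_congr (hiff x)
    rw [this, card_filter_sunIndex]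
    exact dvd_mul_left _ _

lemma not_hasConnectedPartition_sunRel {a b : ℕ} (hk : 2 ≤ k) (ha : k < a) (hb : k < b)
    (hab : a = b + 1 ∨ a = b + 2) :
    ¬ HasConnectedPartition (SimpleGraph.fromRel (sunRel n (fun _ => k) body)) {a, b} := by
  rw [hasConnectedPartition_pair_iff]
  rintro ⟨A, hA, hA', rfl, rfl⟩
  rcases card_of_connected_of_connected_compl hA hA' with h | h | ⟨h, h'⟩
  · omega
  · omega
  · have h2 : k + 1 ∣ 1 ∨ k + 1 ∣ 2 := hab.imp
      (fun hab => (Nat.dvd_add_right h').1 (by rwa [← hab]))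
      (fun hab => (Nat.dvd_add_right h').1 (by rwa [← hab]))
    rcases h2 with h2 | h2 <;> have := Nat.le_of_dvd (by norm_num) h2 <;> omega

/-- A predicate that is constant along edges of a sun graph is constant, provided that it is
constant on the body. -/
lemma iff_of_forall_adj_sunRel {P : Fin n ⊕ ((_ : Fin n) × Fin k) → Prop}
    (hP : ∀ u v, (SimpleGraph.fromRel (sunRel n (fun _ => k) body)).Adj u v → (P u ↔ P v))
    (hbody : ∀ i j, P (.inl i) ↔ P (.inl j)) (u v) : P u ↔ P v := by
  have hray : ∀ i (m : ℕ) (hm : m < k), P (.inr ⟨i, ⟨m, hm⟩⟩) ↔ P (.inl i) := by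
    intro i m
    induction m with
    | zero =>
      exact fun hm => (hP _ _ ((SimpleGraph.fromRel_adj _ _ _).2
        ⟨by simp, .inl (by simp [sunRel])⟩)).symm
    | succ m ih =>
      exact fun hm => (hP _ _ ((SimpleGraph.fromRel_adj _ _ _).2
        ⟨by simp, .inr (by simp [sunRel])⟩)).trans (ih (m.lt_succ_self.trans hm))
  have hroot : ∀ x, P x ↔ P (.inl (sunIndex x)) := by
    rintro (i | ⟨i, j⟩)
    · rfl
    · exact hray i j j.2
  rw [hroot u, hroot v]
  exact hbody _ _

lemma iff_of_forall_adj_sunGraph (hn : 2 ≤ n) {P : Fin n ⊕ ((_ : Fin n) × Fin k) → Prop}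
    (hP : ∀ u v, (sunGraph n fun _ => k).Adj u v → (P u ↔ P v)) (u v) : P u ↔ P v := by
  refine iff_of_forall_adj_sunRel hP ?_ u v
  have hzero : ∀ (m : ℕ) (hm : m < n), P (.inl ⟨m, hm⟩) ↔ P (.inl ⟨0, by omega⟩) := by
    intro m
    induction m with
    | zero => exact fun _ => Iff.rfl
    | succ m ih =>
      exact fun hm => (hP _ _ ((SimpleGraph.fromRel_adj _ _ _).2
        ⟨by simp, .inr (by simp [sunRel, Nat.mod_eq_of_lt hm])⟩)).trans
          (ih (m.lt_succ_self.trans hm))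
  exact fun i j => (hzero i i.2).trans (hzero j j.2).symm

lemma iff_of_forall_adj_completeSunGraph {P : Fin n ⊕ ((_ : Fin n) × Fin k) → Prop}
    (hP : ∀ u v, (completeSunGraph n fun _ => k).Adj u v → (P u ↔ P v)) (u v) : P u ↔ P v := by
  refine iff_of_forall_adj_sunRel hP (fun i j => ?_) u v
  by_cases hij : i = j
  · rw [hij]
  · exact hP _ _ ((SimpleGraph.fromRel_adj _ _ _).2 ⟨by simpa using hij, .inl hij⟩)

lemma not_ePositive_sunRel (hn : 3 ≤ n) (hk : 2 ≤ k)
    (hG : ∀ P : Fin n ⊕ ((_ : Fin n) × Fin k) → Prop,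
      (∀ u v, (SimpleGraph.fromRel (sunRel n (fun _ => k) body)).Adj u v → (P u ↔ P v)) →
        ∀ u v, P u ↔ P v) :
    ¬ EPositive (csf (SimpleGraph.fromRel (sunRel n (fun _ => k) body))) := by
  intro h
  have : Nonempty (Fin n ⊕ ((_ : Fin n) × Fin k)) := ⟨.inl ⟨0, by omega⟩⟩
  have hN : 3 * (k + 1) ≤ n * (k + 1) := Nat.mul_le_mul_right _ hn
  have hV : Fintype.card (Fin n ⊕ ((_ : Fin n) × Fin k)) = n * (k + 1) := by
    simp
    ring
  obtain ⟨a, b, hab, hsum⟩ : ∃ a b, (a = b + 1 ∨ a = b + 2) ∧ a + b = n * (k + 1) := by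
    rcases Nat.even_or_odd' (n * (k + 1)) with ⟨c, hc | hc⟩
    · exact ⟨c + 1, c - 1, by omega, by omega⟩
    · exact ⟨c + 1, c, by omega, by omega⟩
  refine not_hasConnectedPartition_sunRel hk (by omega) (by omega) hab
    (h.hasConnectedPartition hG (by omega) (by omega) (fun hdvd => ?_) (hV.trans hsum.symm))
  have h2 : b ∣ 1 ∨ b ∣ 2 := hab.imp (fun hab => (Nat.dvd_add_right dvd_rfl).1 (by rwa [← hab]))
    (fun hab => (Nat.dvd_add_right dvd_rfl).1 (by rwa [← hab]))
  rcases h2 with h2 | h2 <;> have := Nat.le_of_dvd (by norm_num) h2 <;> omega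

end Sun

/-- For `n ≥ 3` and `k ≥ 2`, if `n(k+1)` is even then neither `S(n;k)` nor
`S̄(n;k)` has a connected partition of type `(n(k+1)/2 + 1, n(k+1)/2 - 1)`; if `n(k+1)` is
odd, neither has one of type `((n(k+1)+1)/2, (n(k+1)-1)/2)`. Consequently neither graph is
`e`-positive. -/
theorem sun_equal_rays_not_ePositive (n k : ℕ) (hn : 3 ≤ n) (hk : 2 ≤ k) :
    (Even (n * (k + 1)) →
      ¬ HasConnectedPartition (sunGraph n fun _ => k)
          {n * (k + 1) / 2 + 1, n * (k + 1) / 2 - 1} ∧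
      ¬ HasConnectedPartition (completeSunGraph n fun _ => k)
          {n * (k + 1) / 2 + 1, n * (k + 1) / 2 - 1}) ∧
    (Odd (n * (k + 1)) →
      ¬ HasConnectedPartition (sunGraph n fun _ => k)
          {(n * (k + 1) + 1) / 2, (n * (k + 1) - 1) / 2} ∧
      ¬ HasConnectedPartition (completeSunGraph n fun _ => k)
          {(n * (k + 1) + 1) / 2, (n * (k + 1) - 1) / 2}) ∧
    ¬ EPositive (csf (sunGraph n fun _ => k)) ∧
    ¬ EPositive (csf (completeSunGraph n fun _ => k)) := by
  have hN : 3 * (k + 1) ≤ n * (k + 1) := Nat.mul_le_mul_right _ hn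
  refine ⟨fun h => ?_, fun h => ?_, ?_, ?_⟩
  · obtain ⟨c, hc⟩ := h
    constructor <;> exact not_hasConnectedPartition_sunRel hk (by omega) (by omega) (by omega)
  · obtain ⟨c, hc⟩ := h
    constructor <;> exact not_hasConnectedPartition_sunRel hk (by omega) (by omega) (by omega)
  · exact not_ePositive_sunRel hn hk fun P hP => iff_of_forall_adj_sunGraph (by omega) hP
  · exact not_ePositive_sunRel hn hk fun P hP => iff_of_forall_adj_completeSunGraph hP
end

section
/- Let n ≥ 3. If n is even, the coefficient of e_{(n+1, n−1)} in the expansion of X_{S(n;1)} in the elementary symmetric function basis equals 2n(1−n). If n is odd, the coefficient of e_{(n, n)} in X_{S(n;1)} equals n(1−n). -/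
/-- Over `ℂ` the elementary symmetric polynomials can be given arbitrary values. -/
theorem exists_esymm_eq (M : ℕ) (ε : ℕ → ℂ) (hε : ε 0 = 1) :
    ∃ x : Fin M → ℂ, ∀ j ≤ M, MvPolynomial.aeval x (MvPolynomial.esymm (Fin M) ℂ j) = ε j := by
  classical
  set P : Polynomial ℂ :=
    ∑ j ∈ Finset.range (M + 1), Polynomial.C ((-1) ^ j * ε j) * Polynomial.X ^ (M - j) with hP
  have hcoeff : ∀ j ≤ M, P.coeff (M - j) = (-1) ^ j * ε j := by
    intro j hj
    simp only [hP, Polynomial.finsetSum_coeff, Polynomial.coeff_C_mul, Polynomial.coeff_X_pow]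
    rw [Finset.sum_eq_single j]
    · simp
    · intro b hb hbj
      rw [Finset.mem_range] at hb
      rw [if_neg (by omega), mul_zero]
    · intro h
      exact absurd (Finset.mem_range.2 (by omega)) h
  have hle : P.natDegree ≤ M := by
    refine Polynomial.natDegree_sum_le_of_forall_le _ _ fun j _ => ?_
    exact (Polynomial.natDegree_C_mul_X_pow_le _ _).trans (Nat.sub_le _ _)
  have htop : P.coeff M = 1 := by simpa [hε] using hcoeff 0 (Nat.zero_le _)
  have hdeg : P.natDegree = M :=
    Polynomial.natDegree_eq_of_le_of_coeff_ne_zero hle (by simp [htop])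
  have hlead : P.leadingCoeff = 1 := by rw [Polynomial.leadingCoeff, hdeg, htop]
  have hcard : Multiset.card P.roots = P.natDegree :=
    Polynomial.splits_iff_card_roots.mp (IsAlgClosed.splits P)
  obtain ⟨x, hx⟩ : ∃ x : Fin M → ℂ, Finset.univ.val.map x = P.roots := by
    have hlen : P.roots.toList.length = M := by simp [hcard, hdeg]
    refine ⟨fun i => P.roots.toList.get (i.cast hlen.symm), ?_⟩
    conv_rhs => rw [← Multiset.coe_toList P.roots]
    rw [Fin.univ_val_map]
    congr 1
    refine List.ext_getElem (by simp [hlen]) fun i _ _ => by simp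
  refine ⟨x, fun j hj => ?_⟩
  rw [MvPolynomial.aeval_esymm_eq_multiset_esymm, hx]
  have h := Polynomial.coeff_eq_esymm_roots_of_card hcard (k := M - j) (by omega)
  rw [hcoeff j hj, hlead, hdeg, Nat.sub_sub_self hj, one_mul] at h
  exact (mul_left_cancel₀ (pow_ne_zero _ (by norm_num)) h).symm

/-- The Newton identities when the elementary symmetric functions are the indicator of a set of odd
numbers. -/
theorem psum_recurrence {ι : Type*} [Fintype ι] (x : ι → ℂ) (A : Finset ℕ) (hA : ∀ j ∈ A, Odd j)
    {M : ℕ} (hx : ∀ j, 0 < j → j ≤ M →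
      MvPolynomial.aeval x (MvPolynomial.esymm ι ℂ j) = if j ∈ A then 1 else 0)
    {m : ℕ} (hm : 0 < m) (hmM : m ≤ M) :
    ∑ i, x i ^ m = (if m ∈ A then (m : ℂ) else 0) +
      ∑ j ∈ A with j < m, ∑ i, x i ^ (m - j) := by
  classical
  have h := congrArg (MvPolynomial.aeval x) (MvPolynomial.psum_eq_mul_esymm_sub_sum ι ℂ m hm)
  have hp : ∀ k, MvPolynomial.aeval x (MvPolynomial.psum ι ℂ k) = ∑ i, x i ^ k := by
    intro k; simp [MvPolynomial.psum]
  simp only [map_sub, map_mul, map_sum, map_pow, map_neg, map_one, map_natCast, hp, hx m hm hmM] at h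
  rw [h, sub_eq_add_neg, ← Finset.sum_neg_distrib]
  congr 1
  · split_ifs with hmA
    · have : Even (m + 1) := (hA m hmA).add_one
      simp [this.neg_one_pow]
    · simp
  · rw [Finset.sum_filter, Finset.Nat.sum_antidiagonal_eq_sum_range_succ_mk, Finset.sum_filter]
    have hL : ∀ k ∈ Finset.range m.succ, (if k ∈ Set.Ioo 0 m then
        -((-1) ^ k * MvPolynomial.aeval x (MvPolynomial.esymm ι ℂ k) * ∑ i, x i ^ (m - k)) else 0)
        = if k ∈ A then (if k < m then ∑ i, x i ^ (m - k) else 0) else 0 := by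
      intro k hk
      rw [Finset.mem_range] at hk
      by_cases hkA : k ∈ A
      · have hodd := hA k hkA
        have h0 : 0 < k := hodd.pos
        by_cases hkm : k < m
        · rw [if_pos ⟨h0, hkm⟩, hx k h0 (by omega)]
          simp [hkA, hkm, hodd.neg_one_pow]
        · rw [if_neg (fun h => hkm h.2)]
          simp [hkm]
      · by_cases hk0 : k ∈ Set.Ioo 0 m
        · rw [if_pos hk0, hx k hk0.1 (by omega)]
          simp [hkA]
        · simp [hk0, hkA]
    rw [Finset.sum_congr rfl hL, ← Finset.sum_filter, ← Finset.sum_filter, ← Finset.sum_filter]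
    refine Finset.sum_congr ?_ fun _ _ => rfl
    ext k
    simp only [Finset.mem_filter, Finset.mem_range]
    constructor
    · rintro ⟨⟨_, h1⟩, h2⟩; exact ⟨h1, h2⟩
    · rintro ⟨h1, h2⟩; exact ⟨⟨by omega, h1⟩, h2⟩

/-- The power sums used for odd `n`. -/
theorem psum_of_esymm_odd {ι : Type*} [Fintype ι] (x : ι → ℂ) {n : ℕ} (hn : 3 ≤ n) (ho : Odd n)
    (hx : ∀ j, 0 < j → j ≤ 2 * n →
      MvPolynomial.aeval x (MvPolynomial.esymm ι ℂ j) = if j ∈ ({n} : Finset ℕ) then 1 else 0) :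
    (∑ i, x i = 0) ∧ (∀ k, 0 < k → k ≤ n - 2 → ∑ i, x i ^ (2 * k) = 0) ∧
      ∑ i, x i ^ (2 * n) = n := by
  have rec' := fun m => psum_recurrence x {n} (by simpa using ho) hx (m := m)
  have small : ∀ m, 0 < m → m < n → ∑ i, x i ^ m = 0 := by
    intro m h0 hm
    rw [rec' m h0 (by omega), if_neg (by simp; omega), Finset.filter_singleton, if_neg (by omega)]
    simp
  have large : ∀ m, n < m → m ≤ 2 * n → ∑ i, x i ^ m = ∑ i, x i ^ (m - n) := by
    intro m h0 hm
    rw [rec' m (by omega) hm, if_neg (by simp; omega), Finset.filter_singleton, if_pos h0]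
    simp
  refine ⟨by simpa using small 1 (by omega) (by omega), fun k hk hkn => ?_, ?_⟩
  · obtain ⟨r, rfl⟩ := ho
    rcases lt_or_ge (2 * k) (2 * r + 1) with h | h
    · exact small _ (by omega) h
    · rw [large _ (by omega) (by omega)]
      exact small _ (by omega) (by omega)
  · rw [large _ (by omega) le_rfl, show 2 * n - n = n by omega, rec' n (by omega) (by omega)]
    simp [Finset.filter_singleton]

/-- The power sums used for even `n`. -/
theorem psum_of_esymm_even {ι : Type*} [Fintype ι] (x : ι → ℂ) {n : ℕ} (hn : 3 ≤ n) (he : Even n)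
    (hx : ∀ j, 0 < j → j ≤ 2 * n → MvPolynomial.aeval x (MvPolynomial.esymm ι ℂ j) =
      if j ∈ ({n + 1, n - 1} : Finset ℕ) then 1 else 0) :
    (∑ i, x i = 0) ∧ (∀ k, 0 < k → k ≤ n - 2 → ∑ i, x i ^ (2 * k) = 0) ∧
      ∑ i, x i ^ (2 * n) = 2 * n := by
  obtain ⟨r, rfl⟩ := he
  obtain ⟨s, rfl⟩ : ∃ s, r = s + 2 := ⟨r - 2, by omega⟩
  have rec' := fun m => psum_recurrence x {s + 2 + (s + 2) + 1, s + 2 + (s + 2) - 1}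
    (by simp [Nat.odd_iff]; omega) hx (m := m)
  have small : ∀ m, 0 < m → m < 2 * s + 3 → ∑ i, x i ^ m = 0 := by
    intro m h0 hm
    rw [rec' m h0 (by omega), if_neg (by simp; omega), Finset.filter_insert, if_neg (by omega),
      Finset.filter_singleton, if_neg (by omega)]
    simp
  have mid : ∑ i, x i ^ (2 * s + 3) = 2 * s + 3 := by
    rw [rec' _ (by omega) (by omega), if_pos (by simp; omega), Finset.filter_insert,
      if_neg (by omega), Finset.filter_singleton, if_neg (by omega)]
    simp
  have mid' : ∑ i, x i ^ (2 * s + 5) = 2 * s + 5 := by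
    rw [rec' _ (by omega) (by omega), if_pos (by simp; omega), Finset.filter_insert,
      if_neg (by omega), Finset.filter_singleton, if_pos (by omega), Finset.sum_singleton,
      small _ (by omega) (by omega)]
    simp
  have large : ∀ m, 2 * s + 5 < m → m ≤ 4 * s + 8 →
      ∑ i, x i ^ m = ∑ i, x i ^ (m - (2 * s + 5)) + ∑ i, x i ^ (m - (2 * s + 3)) := by
    intro m h0 hm
    rw [rec' m (by omega) (by omega), if_neg (by simp; omega), Finset.filter_insert,
      if_pos (by omega), Finset.filter_singleton, if_pos (by omega),
      Finset.sum_pair (by omega), zero_add, show s + 2 + (s + 2) + 1 = 2 * s + 5 by omega,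
      show s + 2 + (s + 2) - 1 = 2 * s + 3 by omega]
  have mid'' : ∑ i, x i ^ (2 * s + 4) = ∑ i, x i ^ 1 := by
    rw [rec' _ (by omega) (by omega), if_neg (by simp; omega), Finset.filter_insert,
      if_neg (by omega), Finset.filter_singleton, if_pos (by omega), zero_add,
      Finset.sum_singleton, show 2 * s + 4 - (s + 2 + (s + 2) - 1) = 1 by omega]
  refine ⟨by simpa using small 1 (by omega) (by omega), fun k hk hkn => ?_, ?_⟩
  · rcases lt_trichotomy k (s + 2) with h | rfl | h
    · exact small _ (by omega) (by omega)
    · rw [show 2 * (s + 2) = 2 * s + 4 by ring, mid'', small 1 (by omega) (by omega)]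
    · rw [large _ (by omega) (by omega), small _ (by omega) (by omega),
        small _ (by omega) (by omega), add_zero]
  · rw [large _ (by omega) (by omega),
      show 2 * (s + 2 + (s + 2)) - (2 * s + 5) = 2 * s + 3 by omega,
      show 2 * (s + 2 + (s + 2)) - (2 * s + 3) = 2 * s + 5 by omega, mid, mid']
    push_cast; ring

/-- Sums over words of products of matrix entries are given by matrix powers. -/
theorem sum_chain_eq_pow {ι : Type*} [Fintype ι] [DecidableEq ι] (N : Matrix ι ι ℂ) (k : ℕ)
    (g : ι → ι → ℂ) :
    ∑ κ : Fin (k + 1) → ι, (∏ i : Fin k, N (κ i.castSucc) (κ i.succ)) * g (κ 0) (κ (Fin.last k)) =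
      ∑ a, ∑ b, (N ^ k) a b * g a b := by
  induction k generalizing g with
  | zero =>
    rw [← (Equiv.funUnique (Fin 1) ι).symm.sum_comp]
    simp [Matrix.one_apply]
  | succ k ih =>
    rw [← (Fin.snocEquiv fun _ : Fin (k + 2) => ι).sum_comp, Fintype.sum_prod_type, Finset.sum_comm]
    have key : ∀ κ : Fin (k + 1) → ι, ∑ c, (∏ i : Fin (k + 1),
        N ((Fin.snocEquiv fun _ : Fin (k + 2) => ι) (c, κ) i.castSucc)
          ((Fin.snocEquiv fun _ : Fin (k + 2) => ι) (c, κ) i.succ)) *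
        g ((Fin.snocEquiv fun _ : Fin (k + 2) => ι) (c, κ) 0)
          ((Fin.snocEquiv fun _ : Fin (k + 2) => ι) (c, κ) (Fin.last (k + 1))) =
        (∏ i : Fin k, N (κ i.castSucc) (κ i.succ)) *
          (fun a b => ∑ c, N b c * g a c) (κ 0) (κ (Fin.last k)) := by
      intro κ
      rw [Finset.mul_sum]
      refine Finset.sum_congr rfl fun c _ => ?_
      rw [Fin.prod_univ_castSucc]
      have h0 : (Fin.snoc κ c : Fin (k + 2) → ι) 0 = κ 0 := by
        rw [← Fin.castSucc_zero, Fin.snoc_castSucc (α := fun _ => ι)]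
      simp only [Fin.snocEquiv, Equiv.coe_fn_mk, Fin.snoc_castSucc, Fin.succ_last, Fin.snoc_last,
        ← Fin.castSucc_succ, h0, mul_assoc]
    refine (Finset.sum_congr rfl fun κ _ => key κ).trans
      ((ih fun a b => ∑ c, N b c * g a c).trans ?_)
    refine Finset.sum_congr rfl fun a _ => ?_
    simp only [pow_succ, Matrix.mul_apply, Finset.sum_mul, Finset.mul_sum]
    rw [Finset.sum_comm]
    simp only [mul_assoc]

/-- Weighted closed proper walks: if the power sums `q_1, …, q_{n-2}` of the weights vanish, then
the weighted count of proper colourings of `C_n` is a multiple of `q_n`. -/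
theorem sum_cycle_colourings {ι : Type*} [Fintype ι] [DecidableEq ι] (y : ι → ℂ) (m : ℕ)
    (hm : 1 ≤ m) (hy : ∀ k, 0 < k → k ≤ m → ∑ i, y i ^ k = 0) :
    ∑ κ : Fin (m + 2) → ι, (∏ i, if κ i = κ (i + 1) then 0 else y (κ i)) =
      (-1) ^ (m + 1) * (m + 1) * ∑ i, y i ^ (m + 2) := by
  obtain ⟨N, hN⟩ : ∃ N : Matrix ι ι ℂ, ∀ a b, N a b = if a = b then 0 else y a :=
    ⟨Matrix.of fun a b => if a = b then 0 else y a, fun _ _ => rfl⟩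
  have hmul : ∀ (A : Matrix ι ι ℂ) a c, (A * N) a c = ∑ b, A a b * y b - A a c * y c := by
    intro A a c
    rw [Matrix.mul_apply, ← Finset.sum_erase_add _ _ (Finset.mem_univ c),
      ← Finset.sum_erase_add _ (fun b => A a b * y b) (Finset.mem_univ c)]
    have : ∀ b ∈ Finset.univ.erase c, A a b * N b c = A a b * y b := by
      intro b hb
      simp [hN, Finset.ne_of_mem_erase hb]
    rw [Finset.sum_congr rfl this]
    simp [hN]
  have hpow : ∀ k ≤ m, ∀ a b, (N ^ (k + 1)) a b =
      (-1) ^ (k + 1) * (if a = b then y a ^ (k + 1) else 0) +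
        (-1) ^ k * ∑ i ∈ Finset.range (k + 1), y a ^ (i + 1) * y b ^ (k - i) := by
    intro k
    induction k with
    | zero =>
      intro _ a b
      by_cases h : a = b <;> simp [hN, h]
    | succ k ih =>
      intro hk a c
      rw [pow_succ, hmul]
      simp only [ih (by omega)]
      have h1 : ∑ b, ((-1) ^ (k + 1) * (if a = b then y a ^ (k + 1) else 0) +
          (-1) ^ k * ∑ i ∈ Finset.range (k + 1), y a ^ (i + 1) * y b ^ (k - i)) * y b =
          (-1) ^ (k + 1) * y a ^ (k + 2) := by
        simp only [add_mul, Finset.sum_add_distrib]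
        have : ∑ b, ((-1) ^ k * ∑ i ∈ Finset.range (k + 1), y a ^ (i + 1) * y b ^ (k - i)) * y b
            = 0 := by
          simp only [Finset.mul_sum, Finset.sum_mul]
          rw [Finset.sum_comm]
          refine Finset.sum_eq_zero fun i hi => ?_
          have h := hy (k - i + 1) (by omega) (by omega)
          calc _ = (-1) ^ k * y a ^ (i + 1) * ∑ b, y b ^ (k - i + 1) := by
                rw [Finset.mul_sum]
                refine Finset.sum_congr rfl fun b _ => by ring
            _ = 0 := by rw [h, mul_zero]
        rw [this, add_zero]
        simp only [mul_ite, ite_mul, mul_zero, zero_mul, Finset.sum_ite_eq, Finset.mem_univ, if_true]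
        ring
      rw [h1, Finset.sum_range_succ _ (k + 1)]
      have h2 : ∑ i ∈ Finset.range (k + 1), y a ^ (i + 1) * y c ^ (k + 1 - i) =
          (∑ i ∈ Finset.range (k + 1), y a ^ (i + 1) * y c ^ (k - i)) * y c := by
        rw [Finset.sum_mul]
        refine Finset.sum_congr rfl fun i hi => ?_
        rw [Finset.mem_range] at hi
        rw [show k + 1 - i = k - i + 1 by omega]
        ring
      rw [h2]
      by_cases h : a = c
      · subst h
        simp only [if_true, Nat.sub_self, pow_zero]
        ring
      · simp only [if_neg h, Nat.sub_self, pow_zero]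
        ring
  have hchain := sum_chain_eq_pow N (m + 1) fun a b => N b a
  have hprod : ∀ κ : Fin (m + 2) → ι, (∏ i, if κ i = κ (i + 1) then 0 else y (κ i)) =
      (∏ i : Fin (m + 1), N (κ i.castSucc) (κ i.succ)) * N (κ (Fin.last (m + 1))) (κ 0) := by
    intro κ
    rw [Fin.prod_univ_castSucc]
    simp [hN, Fin.coeSucc_eq_succ]
  rw [Finset.sum_congr rfl fun κ _ => hprod κ]
  refine hchain.trans ?_
  have hrow : ∀ a, ∑ b, (N ^ (m + 1)) a b * N b a =
      ∑ b, (N ^ (m + 1)) a b * y b - (N ^ (m + 1)) a a * y a := by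
    intro a
    rw [← hmul, Matrix.mul_apply]
  rw [Finset.sum_congr rfl fun a _ => hrow a]
  simp only [hpow m le_rfl, if_true, Finset.sum_sub_distrib, add_mul, Finset.sum_add_distrib]
  have e1 : ∑ a, ∑ b, (-1) ^ (m + 1) * (if a = b then y a ^ (m + 1) else 0) * y b =
      ∑ a, (-1) ^ (m + 1) * y a ^ (m + 1) * y a := by
    refine Finset.sum_congr rfl fun a _ => ?_
    simp
  have e2 : ∑ a, ∑ b, (-1) ^ m *
      (∑ i ∈ Finset.range (m + 1), y a ^ (i + 1) * y b ^ (m - i)) * y b = 0 := by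
    calc _ = ∑ i ∈ Finset.range (m + 1),
          (-1) ^ m * ((∑ a, y a ^ (i + 1)) * ∑ b, y b ^ (m - i + 1)) := by
          simp only [Finset.sum_mul_sum]
          simp only [Finset.mul_sum, Finset.sum_mul]
          rw [Finset.sum_comm]
          rw [Finset.sum_congr rfl fun b _ => Finset.sum_comm, Finset.sum_comm]
          refine Finset.sum_congr rfl fun i _ => ?_
          rw [Finset.sum_comm]
          refine Finset.sum_congr rfl fun a _ => Finset.sum_congr rfl fun b _ => by ring
      _ = 0 := by
          refine Finset.sum_eq_zero fun i hi => ?_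
          rw [Finset.mem_range] at hi
          rcases Nat.lt_or_ge i m with h | h
          · rw [hy (i + 1) (by omega) (by omega)]; simp
          · rw [hy (m - i + 1) (by omega) (by omega)]; simp
  have e3 : ∑ a, (-1) ^ m *
      (∑ i ∈ Finset.range (m + 1), y a ^ (i + 1) * y a ^ (m - i)) * y a =
      (-1) ^ m * (m + 1) * ∑ a, y a ^ (m + 2) := by
    rw [Finset.mul_sum]
    refine Finset.sum_congr rfl fun a _ => ?_
    have : ∀ i ∈ Finset.range (m + 1), y a ^ (i + 1) * y a ^ (m - i) = y a ^ (m + 1) := by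
      intro i hi
      rw [Finset.mem_range] at hi
      rw [← pow_add, show i + 1 + (m - i) = m + 1 by omega]
    rw [Finset.sum_congr rfl this]
    simp
    ring
  rw [e1, e2, e3]
  ring

open MvPowerSeries in
/-- The substitution `x_i ↦ x_i t`, for finitely many nonzero scalars `x_i`. -/
theorem hasSubst_scale {x : ℕ → ℂ} {M : ℕ} (hx : ∀ i, M ≤ i → x i = 0) :
    HasSubst fun i : ℕ => (monomial (Finsupp.single () 1) (x i) : MvPowerSeries Unit ℂ) where
  const_coeff s := by
    rw [← coeff_zero_eq_constantCoeff_apply, coeff_monomial_ne]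
    · exact IsNilpotent.zero
    · intro h
      simpa using DFunLike.congr_fun h ()
  coeff_zero d := by
    refine (Set.finite_lt_nat M).subset fun i hi => ?_
    by_contra h
    exact hi (by simp [hx i (not_lt.1 h)])

open MvPowerSeries in
theorem prod_scale_pow (x : ℕ → ℂ) (d : ℕ →₀ ℕ) :
    (d.prod fun i e => (monomial (Finsupp.single () 1) (x i) : MvPowerSeries Unit ℂ) ^ e) =
      monomial (Finsupp.single () (d.sum fun _ e => e)) (d.prod fun i e => x i ^ e) := by
  classical
  simp only [monomial_pow]
  rw [Finsupp.prod, prod_monomial, Finsupp.prod]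
  congr 2
  rw [Finsupp.sum, Finsupp.single_finsetSum]
  simp

open MvPowerSeries in
/-- If the coefficients of `F` count the exponents of a family of monomials of degree `k`, then
scaling evaluates `F` to the sum of the values of these monomials, in degree `k`. -/
theorem subst_scale_eq {τ : Type*} {x : ℕ → ℂ} {M : ℕ} (hx : ∀ i, M ≤ i → x i = 0)
    (F : MvPowerSeries ℕ ℚ) (T : Finset τ) (w : τ → ℕ →₀ ℕ) (k : ℕ)
    (hsupp : ∀ t ∈ T, (w t).support ⊆ Finset.range M)
    (hdeg : ∀ t ∈ T, ((w t).sum fun _ e => e) = k)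
    (hF : ∀ d : ℕ →₀ ℕ, d.support ⊆ Finset.range M →
      coeff d F = ∑ t ∈ T, if w t = d then 1 else 0) :
    subst (fun i : ℕ => (monomial (Finsupp.single () 1) (x i) : MvPowerSeries Unit ℂ)) F =
      monomial (Finsupp.single () k) (∑ t ∈ T, (w t).prod fun i e => x i ^ e) := by
  classical
  refine MvPowerSeries.ext fun e => ?_
  rw [coeff_subst (hasSubst_scale hx)]
  have hterm : ∀ d : ℕ →₀ ℕ, coeff d F • coeff e (d.prod fun i e =>
      (monomial (Finsupp.single () 1) (x i) : MvPowerSeries Unit ℂ) ^ e) =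
      ∑ t ∈ T, if w t = d then
        coeff e (monomial (Finsupp.single () k) ((w t).prod fun i e => x i ^ e)) else 0 := by
    intro d
    rw [prod_scale_pow]
    by_cases hd : d.support ⊆ Finset.range M
    · rw [hF d hd, Finset.sum_smul]
      refine Finset.sum_congr rfl fun t ht => ?_
      split_ifs with h
      · rw [one_smul, ← h, hdeg t ht]
      · rw [zero_smul]
    · obtain ⟨i, hi, hiM⟩ := Finset.not_subset.1 hd
      have h0 : (d.prod fun i e => x i ^ e) = 0 := by
        refine Finset.prod_eq_zero hi ?_
        change x i ^ d i = 0
        rw [hx i (by simpa using hiM), zero_pow (Finsupp.mem_support_iff.1 hi)]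
      rw [h0, map_zero, map_zero, smul_zero]
      refine (Finset.sum_eq_zero fun t ht => if_neg ?_).symm
      rintro rfl
      exact hd (hsupp t ht)
  rw [finsum_congr hterm, finsum_eq_sum_of_support_subset (s := T.image w)]
  · rw [Finset.sum_comm, map_sum, map_sum]
    refine Finset.sum_congr rfl fun t ht => ?_
    rw [Finset.sum_ite_eq, if_pos (Finset.mem_image_of_mem w ht)]
  · intro d hd
    obtain ⟨t, ht, h⟩ := Finset.exists_ne_zero_of_sum_ne_zero hd
    rw [ite_ne_right_iff] at h
    simpa using ⟨t, ht, h.1⟩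

open MvPowerSeries in
theorem subst_scale_esym {x : ℕ → ℂ} {M : ℕ} (hx : ∀ i, M ≤ i → x i = 0) (k : ℕ) :
    subst (fun i : ℕ => (monomial (Finsupp.single () 1) (x i) : MvPowerSeries Unit ℂ)) (esym k) =
      monomial (Finsupp.single () k) (∑ S ∈ (Finset.range M).powersetCard k, ∏ i ∈ S, x i) := by
  classical
  have happ : ∀ (S : Finset ℕ) i, (∑ j ∈ S, Finsupp.single j 1 : ℕ →₀ ℕ) i =
      if i ∈ S then 1 else 0 := by
    intro S i
    simp [Finsupp.finsetSum_apply, Finsupp.single_apply]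
  have hsup : ∀ S : Finset ℕ, (∑ j ∈ S, Finsupp.single j 1 : ℕ →₀ ℕ).support = S := by
    intro S
    ext i
    simp [happ]
  rw [subst_scale_eq hx _ ((Finset.range M).powersetCard k) (fun S => ∑ j ∈ S, Finsupp.single j 1) k]
  · congr 1
    refine Finset.sum_congr rfl fun S _ => ?_
    rw [Finsupp.prod, hsup]
    refine Finset.prod_congr rfl fun i hi => ?_
    rw [happ, if_pos hi, pow_one]
  · intro S hS
    rw [hsup]
    exact (Finset.mem_powersetCard.1 hS).1
  · intro S hS
    rw [Finsupp.sum, hsup, Finset.sum_congr rfl fun i hi => (happ S i).trans (if_pos hi)]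
    simpa using (Finset.mem_powersetCard.1 hS).2
  · intro d hd
    change (if _ then _ else _) = _
    have hiff : ∀ S : Finset ℕ, (∑ j ∈ S, Finsupp.single j 1 : ℕ →₀ ℕ) = d ↔
        d.support = S ∧ ∀ i ∈ d.support, d i = 1 := by
      intro S
      constructor
      · rintro rfl
        refine ⟨hsup S, fun i hi => ?_⟩
        rw [hsup] at hi
        rw [happ, if_pos hi]
      · rintro ⟨rfl, h⟩
        ext i
        rw [happ]
        by_cases hi : i ∈ d.support
        · rw [if_pos hi, h i hi]
        · rw [if_neg hi, Finsupp.notMem_support_iff.1 hi]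
    simp only [hiff]
    by_cases h1 : ∀ i ∈ d.support, d i = 1
    · have hs : (d.sum fun _ v => v) = d.support.card := by
        rw [Finsupp.sum, Finset.sum_congr rfl h1]; simp
      simp only [eq_true h1, and_true, Finset.sum_ite_eq, Finset.mem_powersetCard, hd, hs, true_and]
    · simp only [eq_false h1, and_false, false_and, if_false, Finset.sum_const_zero]

open MvPowerSeries in
theorem subst_scale_csf {V : Type} [Fintype V] [DecidableEq V] (G : SimpleGraph V)
    [DecidableRel G.Adj] {x : ℕ → ℂ} {M : ℕ} (hx : ∀ i, M ≤ i → x i = 0) :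
    subst (fun i : ℕ => (monomial (Finsupp.single () 1) (x i) : MvPowerSeries Unit ℂ)) (csf G) =
      monomial (Finsupp.single () (Fintype.card V))
        (∑ κ : V → Fin M with ∀ u v, G.Adj u v → κ u ≠ κ v, ∏ v, x (κ v)) := by
  classical
  have happ : ∀ (κ : V → ℕ) i, (∑ v, Finsupp.single (κ v) 1 : ℕ →₀ ℕ) i =
      Nat.card {v : V // κ v = i} := by
    intro κ i
    simp [Finsupp.finsetSum_apply, Finsupp.single_apply, Fintype.card_subtype]
  rw [subst_scale_eq hx _ (Finset.univ.filter fun κ : V → Fin M => ∀ u v, G.Adj u v → κ u ≠ κ v)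
    (fun κ => ∑ v, Finsupp.single (κ v : ℕ) 1) (Fintype.card V)]
  · congr 1
    refine Finset.sum_congr rfl fun κ _ => ?_
    rw [← Finsupp.prod_finsetSum_index (by simp) (by simp [pow_add])]
    simp
  · intro κ _ i hi
    rw [Finsupp.mem_support_iff, happ (fun v => (κ v : ℕ))] at hi
    have := (Nat.card_pos_iff.1 (Nat.pos_of_ne_zero hi)).1
    obtain ⟨v, rfl⟩ := this.some
    simp
  · intro κ _
    rw [← Finsupp.sum_finsetSum_index (by simp) (by simp)]
    simp
  · intro d hd
    change ((Nat.card _ : ℕ) : ℚ) = _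
    have hiff : ∀ κ : V → ℕ, (∑ v, Finsupp.single (κ v) 1 : ℕ →₀ ℕ) = d ↔
        ∀ i, Nat.card {v : V // κ v = i} = d i := fun κ => by
      simp only [DFunLike.ext_iff, happ]
    rw [Finset.sum_boole, Nat.cast_inj, Finset.filter_filter, ← Fintype.card_subtype,
      ← Nat.card_eq_fintype_card]
    refine (Nat.card_eq_of_bijective (fun κ => ⟨fun v => (κ.1 v : ℕ), fun u v huv h =>
      κ.2.1 u v huv (Fin.ext h), (hiff fun v => (κ.1 v : ℕ)).1 κ.2.2⟩) ⟨?_, ?_⟩).symm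
    · intro κ κ' h
      refine Subtype.ext (funext fun v => Fin.ext ?_)
      exact congrFun (Subtype.ext_iff.1 h) v
    · rintro ⟨κ, hκ, hκd⟩
      have hlt : ∀ v, κ v < M := by
        intro v
        have hne : d (κ v) ≠ 0 := by
          rw [← hκd (κ v)]
          have : Nonempty {u : V // κ u = κ v} := ⟨⟨v, rfl⟩⟩
          exact Nat.card_pos.ne'
        exact Finset.mem_range.1 (hd (Finsupp.mem_support_iff.2 hne))
      exact ⟨⟨fun v => ⟨κ v, hlt v⟩, fun u v huv h => hκ u v huv (congrArg Fin.val h),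
        (hiff κ).2 hκd⟩, rfl⟩

theorem sum_powersetCard_range_eq_esymm {M : ℕ} (x : Fin M → ℂ) (k : ℕ) :
    ∑ S ∈ (Finset.range M).powersetCard k, ∏ i ∈ S, (if h : i < M then x ⟨i, h⟩ else 0) =
      MvPolynomial.aeval x (MvPolynomial.esymm (Fin M) ℂ k) := by
  rw [← Nat.Iio_eq_range, ← Fin.map_valEmbedding_univ, Finset.powersetCard_map, Finset.sum_map]
  simp [MvPolynomial.esymm]

open MvPowerSeries in
/-- Evaluating an `e`-expansion of `csf G` in degree `|V|` at finitely many complex numbers. -/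
theorem sum_colourings_eq_of_csf_eq {V : Type} [Fintype V] [DecidableEq V] (G : SimpleGraph V)
    [DecidableRel G.Adj] (c : Multiset ℕ →₀ ℚ) (hc : csf G = c.sum fun μ a => a • esymM μ)
    {M : ℕ} (x : Fin M → ℂ) :
    ∑ κ : V → Fin M with ∀ u v, G.Adj u v → κ u ≠ κ v, ∏ v, x (κ v) =
      c.sum fun μ a => if μ.sum = Fintype.card V then
        (a : ℂ) * (μ.map fun k => MvPolynomial.aeval x (MvPolynomial.esymm (Fin M) ℂ k)).prod
        else 0 := by
  set X : ℕ → ℂ := fun i => if h : i < M then x ⟨i, h⟩ else 0 with hX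
  have hX0 : ∀ i, M ≤ i → X i = 0 := fun i hi => dif_neg (not_lt.2 hi)
  have hXx : ∀ i : Fin M, X i = x i := fun i => dif_pos i.2
  have hs := hasSubst_scale hX0
  have hmu : ∀ μ : Multiset ℕ, substAlgHom (R := ℚ) hs (esymM μ) =
      monomial (Finsupp.single () μ.sum)
        (μ.map fun k => MvPolynomial.aeval x (MvPolynomial.esymm (Fin M) ℂ k)).prod := by
    intro μ
    induction μ using Multiset.induction with
    | empty =>
      rw [esymM, Multiset.map_zero, Multiset.prod_zero, map_one]
      simp
    | cons k μ ih =>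
      rw [esymM, Multiset.map_cons, Multiset.prod_cons, map_mul, ← esymM, ih, substAlgHom_apply,
        subst_scale_esym hX0, hX, sum_powersetCard_range_eq_esymm, monomial_mul_monomial,
        ← Finsupp.single_add]
      simp
  have h := congrArg (fun F => coeff (Finsupp.single () (Fintype.card V))
    (substAlgHom (R := ℚ) hs F)) hc
  simp only [substAlgHom_apply hs (csf G), subst_scale_csf G hX0, coeff_monomial_same, hXx] at h
  rw [h, Finsupp.sum, map_sum, map_sum, Finsupp.sum]
  refine Finset.sum_congr rfl fun μ _ => ?_
  rw [map_smul, hmu]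
  split_ifs with hμ
  · rw [hμ, Algebra.smul_def, MvPowerSeries.algebraMap_apply, coeff_C_mul, coeff_monomial_same]
    simp
  · have : Finsupp.single () (Fintype.card V) ≠ Finsupp.single () μ.sum := fun h => hμ <| by
      simpa using (DFunLike.congr_fun h ()).symm
    rw [Algebra.smul_def, MvPowerSeries.algebraMap_apply, coeff_C_mul, coeff_monomial_ne this,
      mul_zero]

theorem sunGraph_one_isProper_iff {n : ℕ} (hn : 1 ≤ n) {ι : Type*}
    (κ : Fin (n + 1) ⊕ ((_ : Fin (n + 1)) × Fin 1) → ι) :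
    (∀ u v, (sunGraph (n + 1) fun _ => 1).Adj u v → κ u ≠ κ v) ↔
      (∀ i, κ (Sum.inl i) ≠ κ (Sum.inl (i + 1))) ∧
        ∀ i, κ (Sum.inl i) ≠ κ (Sum.inr ⟨i, 0⟩) := by
  have hval : ∀ i : Fin (n + 1), ((i + 1 : Fin (n + 1)) : ℕ) = ((i : ℕ) + 1) % (n + 1) := by
    intro i
    rw [Fin.val_add, Fin.val_one', Nat.add_mod_mod]
  constructor
  · intro h
    refine ⟨fun i => h _ _ ?_, fun i => h _ _ ?_⟩
    · rw [sunGraph, SimpleGraph.fromRel_adj]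
      refine ⟨?_, Or.inl (hval i)⟩
      obtain ⟨m, rfl⟩ : ∃ m, n = m + 1 := ⟨n - 1, by omega⟩
      simp
    · rw [sunGraph, SimpleGraph.fromRel_adj]
      exact ⟨by simp, Or.inl ⟨rfl, rfl⟩⟩
  · rintro ⟨h1, h2⟩
    have key : ∀ u v, sunRel (n + 1) (fun _ => 1)
        (fun i i' => (i' : ℕ) = ((i : ℕ) + 1) % (n + 1)) u v → κ u ≠ κ v := by
      rintro (i | ⟨i, a⟩) (j | ⟨j, b⟩) h
      · have : j = i + 1 := Fin.ext (by rw [hval]; exact h)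
        exact this ▸ h1 i
      · obtain ⟨rfl, hb⟩ : j = i ∧ (b : ℕ) = 0 := h
        rw [Subsingleton.elim b 0]
        exact h2 j
      · exact h.elim
      · obtain ⟨-, hb⟩ : i = j ∧ (b : ℕ) = (a : ℕ) + 1 := h
        omega
    intro u v huv
    rw [sunGraph, SimpleGraph.fromRel_adj] at huv
    rcases huv.2 with h | h
    · exact key u v h
    · exact (key v u h).symm

/-- When the weights sum to zero, the rays of a sun can be summed out, squaring the weights. -/
theorem sum_sun_colourings {n : ℕ} (hn : 1 ≤ n) {ι : Type*} [Fintype ι] [DecidableEq ι]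
    [DecidableRel (sunGraph (n + 1) fun _ => 1).Adj] (x : ι → ℂ) (hx : ∑ i, x i = 0) :
    ∑ κ : Fin (n + 1) ⊕ ((_ : Fin (n + 1)) × Fin 1) → ι with
        ∀ u v, (sunGraph (n + 1) fun _ => 1).Adj u v → κ u ≠ κ v, ∏ v, x (κ v) =
      (-1) ^ (n + 1) * ∑ κ : Fin (n + 1) → ι,
        ∏ i, if κ i = κ (i + 1) then 0 else x (κ i) ^ 2 := by
  classical
  simp only [sunGraph_one_isProper_iff hn]
  rw [Finset.sum_filter, ← (Equiv.sumArrowEquivProdArrow _ _ ι).symm.sum_comp,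
    Fintype.sum_prod_type, Finset.mul_sum]
  refine Finset.sum_congr rfl fun f _ => ?_
  rw [← ((Equiv.sigmaUnique (Fin (n + 1)) fun _ => Fin 1).symm.arrowCongr
    (Equiv.refl ι)).sum_comp]
  have hterm : ∀ g : Fin (n + 1) → ι,
      (if (∀ i, f i ≠ f (i + 1)) ∧ ∀ i, f i ≠ g i then (∏ i, x (f i)) * ∏ i, x (g i) else 0) =
      (∏ i, if f i = f (i + 1) then 0 else x (f i)) * ∏ i, if f i = g i then 0 else x (g i) := by
    intro g
    by_cases h1 : ∀ i, f i ≠ f (i + 1)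
    · by_cases h2 : ∀ i, f i ≠ g i
      · simp [h1, h2]
      · rw [if_neg fun h => h2 h.2]
        push Not at h2
        obtain ⟨i, hi⟩ := h2
        rw [Finset.prod_eq_zero (f := fun i => if f i = g i then 0 else x (g i))
          (Finset.mem_univ i) (if_pos hi), mul_zero]
    · rw [if_neg fun h => h1 h.1]
      push Not at h1
      obtain ⟨i, hi⟩ := h1
      rw [Finset.prod_eq_zero (f := fun i => if f i = f (i + 1) then 0 else x (f i))
        (Finset.mem_univ i) (if_pos hi), zero_mul]
  calc _ = ∑ g : Fin (n + 1) → ι, (if (∀ i, f i ≠ f (i + 1)) ∧ ∀ i, f i ≠ g i then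
        (∏ i, x (f i)) * ∏ i, x (g i) else 0) := by
        refine Finset.sum_congr rfl fun g _ => ?_
        simp only [Fintype.prod_sum_type, Fintype.prod_sigma]
        simp [Equiv.sumArrowEquivProdArrow]
    _ = (∏ i, if f i = f (i + 1) then 0 else x (f i)) *
          ∏ i, ∑ c, if f i = c then 0 else x c := by
        rw [Finset.sum_congr rfl fun g _ => hterm g, ← Finset.mul_sum, Finset.prod_univ_sum,
          Fintype.piFinset_univ]
    _ = _ := by
        have : ∀ a, ∑ c, (if a = c then 0 else x c) = -x a := by
          intro a
          have h : ∀ c, (if a = c then 0 else x c) = x c - if a = c then x c else 0 := by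
            intro c
            split_ifs <;> simp
          simp [h, Finset.sum_sub_distrib, hx]
        simp only [this]
        rw [← Finset.prod_mul_distrib]
        have hcard : ((-1 : ℂ)) ^ (n + 1) = ∏ _i : Fin (n + 1), (-1 : ℂ) := by simp
        rw [hcard, ← Finset.prod_mul_distrib]
        refine Finset.prod_congr rfl fun i _ => ?_
        split_ifs <;> ring

theorem sum_sun_eq_psum {n : ℕ} (hn : 3 ≤ n) {ι : Type*} [Fintype ι] [DecidableEq ι]
    [DecidableRel (sunGraph n fun _ => 1).Adj] (x : ι → ℂ) (hx : ∑ i, x i = 0)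
    (hx' : ∀ k, 0 < k → k ≤ n - 2 → ∑ i, x i ^ (2 * k) = 0) :
    ∑ κ : Fin n ⊕ ((_ : Fin n) × Fin 1) → ι with
        ∀ u v, (sunGraph n fun _ => 1).Adj u v → κ u ≠ κ v, ∏ v, x (κ v) =
      (1 - n) * ∑ i, x i ^ (2 * n) := by
  obtain ⟨m, rfl⟩ : ∃ m, n = m + 2 := ⟨n - 2, by omega⟩
  rw [sum_sun_colourings (by omega) x hx, sum_cycle_colourings (fun i => x i ^ 2) m (by omega)]
  · simp only [← pow_mul]
    have : ((-1 : ℂ) ^ (m + 1)) * (-1) ^ (m + 1) = 1 := by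
      rw [← mul_pow]; simp
    push_cast
    linear_combination (-((m : ℂ) + 1) * ∑ i, x i ^ (2 * (m + 2))) * this
  · intro k hk hkm
    simp only [← pow_mul]
    exact hx' k hk (by omega)

/-- If `μ₀` is the only partition of `2n` with parts in `A`, then evaluating at numbers whose
elementary symmetric functions are the indicator of `A` extracts `c μ₀`. -/
theorem eCoeff_sun_eq {n : ℕ} (A : Finset ℕ) (μ₀ : Multiset ℕ)
    (hμ₀ : μ₀.sum = 2 * n) (hμ₀A : ∀ k ∈ μ₀, k ∈ A)
    (huniq : ∀ μ : Multiset ℕ, μ.sum = 2 * n → (∀ k ∈ μ, k ∈ A) → μ = μ₀)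
    (c : Multiset ℕ →₀ ℚ) (hc0 : ∀ μ ∈ c.support, 0 ∉ μ)
    (hc : csf (sunGraph n fun _ => 1) = c.sum fun μ a => a • esymM μ)
    [DecidableRel (sunGraph n fun _ => 1).Adj] (h0 : 0 ∉ A) (x : Fin (2 * n) → ℂ)
    (hx : ∀ j, 0 < j → j ≤ 2 * n →
      MvPolynomial.aeval x (MvPolynomial.esymm (Fin (2 * n)) ℂ j) = if j ∈ A then 1 else 0) :
    ∑ κ : Fin n ⊕ ((_ : Fin n) × Fin 1) → Fin (2 * n) with
        ∀ u v, (sunGraph n fun _ => 1).Adj u v → κ u ≠ κ v, ∏ v, x (κ v) = (c μ₀ : ℂ) := by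
  have hle : ∀ μ : Multiset ℕ, μ.sum = 2 * n → ∀ k ∈ μ, k ≤ 2 * n := fun μ hμ k hk =>
    hμ ▸ Multiset.le_sum_of_mem hk
  rw [sum_colourings_eq_of_csf_eq _ c hc x, Finsupp.sum, Finset.sum_eq_single μ₀]
  · rw [if_pos (by simp [hμ₀, two_mul]), Multiset.map_congr rfl (g := fun _ => (1 : ℂ))]
    · simp
    · intro k hk
      rw [hx k (Nat.pos_of_ne_zero fun h => h0 (h ▸ hμ₀A k hk)) (hle _ hμ₀ k hk),
        if_pos (hμ₀A k hk)]
  · intro μ hμ hne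
    split_ifs with hsum
    · have hsum' : μ.sum = 2 * n := by rw [hsum]; simp [two_mul]
      have : ¬ ∀ k ∈ μ, k ∈ A := fun h => hne (huniq μ hsum' h)
      push Not at this
      obtain ⟨k, hk, hkA⟩ := this
      rw [Multiset.prod_eq_zero, mul_zero]
      refine Multiset.mem_map.2 ⟨k, hk, ?_⟩
      rw [hx k (Nat.pos_of_ne_zero fun h => hc0 μ hμ (h ▸ hk)) (hle _ hsum' k hk), if_neg hkA]
    · rfl
  · intro h
    rw [Finsupp.notMem_support_iff.1 h]
    simp

theorem exists_esymm_eq_indicator (M : ℕ) (A : Finset ℕ) :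
    ∃ x : Fin M → ℂ, ∀ j, 0 < j → j ≤ M →
      MvPolynomial.aeval x (MvPolynomial.esymm (Fin M) ℂ j) = if j ∈ A then 1 else 0 := by
  obtain ⟨x, hx⟩ := exists_esymm_eq M (fun j => if j = 0 then 1 else if j ∈ A then 1 else 0) rfl
  exact ⟨x, fun j h0 hj => by rw [hx j hj, if_neg h0.ne']⟩

/-- A multiset of sum `2n` with all parts close to `n` has exactly two parts. -/
theorem exists_pair_of_sum_eq {n : ℕ} (hn : 3 ≤ n) {μ : Multiset ℕ} (hsum : μ.sum = 2 * n)
    (hlb : ∀ k ∈ μ, 2 * n < 3 * k ∧ k < 2 * n) : ∃ a b, μ = {a, b} := by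
  rw [← Multiset.card_eq_two]
  have h1 : μ.card • (2 * n + 1) ≤ (μ.map fun k => 3 * k).sum := by
    rw [← Multiset.card_map (fun k => 3 * k) μ]
    refine Multiset.card_nsmul_le_sum fun j hj => ?_
    obtain ⟨k, hk, rfl⟩ := Multiset.mem_map.1 hj
    exact (hlb k hk).1
  rw [Multiset.sum_map_mul_left, Multiset.map_id', hsum, smul_eq_mul] at h1
  have h3 : μ.card < 3 := by
    by_contra h
    nlinarith
  have hne0 : μ.card ≠ 0 := by
    intro h
    rw [Multiset.card_eq_zero] at h
    simp [h] at hsum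
    omega
  have hne1 : μ.card ≠ 1 := by
    intro h
    obtain ⟨a, rfl⟩ := Multiset.card_eq_one.1 h
    have := (hlb a (by simp)).2
    simp at hsum
    omega
  omega

/-- For `n ≥ 3`: if `n` is even, then `[e_{(n+1,n-1)}] X_{S(n;1)} = 2n(1-n)`;
if `n` is odd, then `[e_{(n,n)}] X_{S(n;1)} = n(1-n)`. -/
theorem sun_all_rays_one_eCoeff (n : ℕ) (hn : 3 ≤ n) :
    (Even n → ∀ c : Multiset ℕ →₀ ℚ, (∀ μ ∈ c.support, 0 ∉ μ) →
      csf (sunGraph n fun _ => 1) = (c.sum fun μ a => a • esymM μ) →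
      c {n + 1, n - 1} = 2 * n * (1 - n)) ∧
    (Odd n → ∀ c : Multiset ℕ →₀ ℚ, (∀ μ ∈ c.support, 0 ∉ μ) →
      csf (sunGraph n fun _ => 1) = (c.sum fun μ a => a • esymM μ) →
      c {n, n} = n * (1 - n)) := by
  classical
  constructor
  · intro he c hc0 hc
    have hn4 : 4 ≤ n := by
      rcases he with ⟨r, rfl⟩
      omega
    obtain ⟨x, hx⟩ := exists_esymm_eq_indicator (2 * n) {n + 1, n - 1}
    obtain ⟨hx1, hx2, hx3⟩ := psum_of_esymm_even x hn he hx
    have h := eCoeff_sun_eq {n + 1, n - 1} {n + 1, n - 1} (by simp; omega) (by simp)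
      (fun μ hsum hμ => by
        obtain ⟨a, b, rfl⟩ := exists_pair_of_sum_eq hn hsum fun k hk => by
          have := hμ k hk
          simp only [Finset.mem_insert, Finset.mem_singleton] at this
          omega
        have ha := hμ a (by simp)
        have hb := hμ b (by simp)
        simp only [Finset.mem_insert, Finset.mem_singleton] at ha hb
        simp only [Multiset.insert_eq_cons, Multiset.sum_cons, Multiset.sum_singleton] at hsum
        rcases ha with rfl | rfl <;> rcases hb with rfl | rfl
        · omega
        · rfl
        · exact Multiset.pair_comm _ _
        · omega) c hc0 hc (by simp; omega) x hx
    rw [sum_sun_eq_psum hn x hx1 hx2, hx3] at h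
    have h' : ((2 * n * (1 - n) : ℚ) : ℂ) = (c {n + 1, n - 1} : ℂ) := by
      rw [← h]; push_cast; ring
    exact_mod_cast h'.symm
  · intro ho c hc0 hc
    obtain ⟨x, hx⟩ := exists_esymm_eq_indicator (2 * n) {n}
    obtain ⟨hx1, hx2, hx3⟩ := psum_of_esymm_odd x hn ho hx
    have h := eCoeff_sun_eq {n} {n, n} (by simp; omega) (by simp)
      (fun μ hsum hμ => by
        simp only [Finset.mem_singleton] at hμ
        obtain ⟨a, b, rfl⟩ := exists_pair_of_sum_eq hn hsum fun k hk => by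
          have := hμ k hk
          omega
        rw [hμ a (by simp), hμ b (by simp)]) c hc0 hc (by simp; omega) x hx
    rw [sum_sun_eq_psum hn x hx1 hx2, hx3] at h
    have h' : ((n * (1 - n) : ℚ) : ℂ) = (c {n, n} : ℂ) := by
      rw [← h]; push_cast; ring
    exact_mod_cast h'.symm
end
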